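/- There exists an absolute constant c ≥ 1 with the following property. Let D ⊆ ℝ² be a convex body with B ⊆ D ⊆ 2B. For n ≥ 1 and x ∈ D, define τₙ(x) := x if x ∈ (1 − 2⁻⁴n⁻²)·D, and otherwise τₙ(x) := t·x where t > 0 is the largest scalar with t·x ∈ (1 − 2⁻⁴n⁻²)·D. Then for every n ≥ 1 and every x ∈ D: c⁻¹·n⁻²·L(τₙ(x),D) ≤ λₙ(x,D) ≤ c·n⁻²·L(τₙ(x),D), and also c⁻¹·n⁻²·U(τₙ(x),D) ≤ λₙ(x,D) ≤ c·n⁻²·U(τₙ(x),D). -/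

import Mathlib

open MeasureTheory Set Pointwise

noncomputable section

abbrev E (d : ℕ) := EuclideanSpace ℝ (Fin d)
abbrev E2 := EuclideanSpace ℝ (Fin 2)

/-- The Christoffel function `λ_n(x, D)` for Lebesgue measure on `D ⊆ ℝ^d`. -/
noncomputable def christoffel (d n : ℕ) (x : E d) (D : Set (E d)) : ℝ :=
  sInf { r : ℝ | ∃ p : MvPolynomial (Fin d) ℝ, p.totalDegree ≤ n ∧
    MvPolynomial.eval (fun i => x i) p = 1 ∧
    r = ∫ y in D, (MvPolynomial.eval (fun i => y i) p) ^ 2 }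

/-- Determinant of the linear part of an affine automorphism of `ℝ^d`. -/
noncomputable def adet {d : ℕ} (T : E d ≃ᵃ[ℝ] E d) : ℝ :=
  LinearMap.det (T.linear : E d →ₗ[ℝ] E d)

/-- The closed unit ball `B` of `ℝ²`. -/
def ballE : Set E2 := Metric.closedBall 0 1

/-- The unit square `S = [0,1]²` in `ℝ²`. -/
def squareS : Set E2 := {y : E2 | y 0 ∈ Icc (0:ℝ) 1 ∧ y 1 ∈ Icc (0:ℝ) 1}

/-- The geometric quantity `L(x, D)`. -/
noncomputable def Lfun (x : E2) (D : Set E2) : ℝ :=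
  sSup { r : ℝ | ∃ T : E2 ≃ᵃ[ℝ] E2, x ∈ T '' ballE ∧ T '' ballE ⊆ D ∧
    r = Real.sqrt (1 - ‖T.symm x‖) * |adet T| }

/-- The geometric quantity `U(x, D)`. -/
noncomputable def Ufun (x : E2) (D : Set E2) : ℝ :=
  sInf { r : ℝ | ∃ T : E2 ≃ᵃ[ℝ] E2, x ∈ T '' ((2:ℝ)⁻¹ • squareS) ∧ D ⊆ T '' squareS ∧
    r = Real.sqrt ((T.symm x) 0 * (T.symm x) 1) * |adet T| }

/-- A convex body in `ℝ²`: a compact convex set with nonempty interior. -/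
def IsConvexBody (D : Set E2) : Prop := Convex ℝ D ∧ IsCompact D ∧ (interior D).Nonempty

/-- The point `(a, b)` of `ℝ²`. -/
noncomputable def e2 (a b : ℝ) : E2 := (WithLp.equiv 2 (Fin 2 → ℝ)).symm ![a, b]


section OneVariable

open Polynomial

/-- The mean of a cosine of integer frequency over a half-period. -/
lemma integral_cos_int_mul (k : ℤ) :
    ∫ θ in (0:ℝ)..Real.pi, Real.cos (k * θ) = if k = 0 then Real.pi else 0 := by
  have h := Polynomial.Chebyshev.integral_measureT_eq_integral_cos
    (f := fun x => (Chebyshev.T ℝ k).eval x)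
  simp only [Chebyshev.T_real_cos] at h
  rw [← h]
  split_ifs with hk
  · subst hk
    exact Polynomial.Chebyshev.integral_eval_T_real_measureT_zero
  · exact Polynomial.Chebyshev.integral_eval_T_real_measureT_of_ne_zero hk

lemma integral_cos_mul_cos (i j : ℕ) :
    ∫ θ in (0:ℝ)..Real.pi, Real.cos (i * θ) * Real.cos (j * θ) =
      if i = j then (if i = 0 then Real.pi else Real.pi / 2) else 0 := by
  have h : ∀ θ : ℝ, Real.cos (i * θ) * Real.cos (j * θ) =
      (1 / 2) * Real.cos (((i:ℤ) - (j:ℤ) : ℤ) * θ) +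
      (1 / 2) * Real.cos (((i:ℤ) + (j:ℤ) : ℤ) * θ) := by
    intro θ
    push_cast
    rw [sub_mul, add_mul, Real.cos_sub, Real.cos_add]
    ring
  simp_rw [h]
  rw [intervalIntegral.integral_add (by apply Continuous.intervalIntegrable; fun_prop)
    (by apply Continuous.intervalIntegrable; fun_prop), intervalIntegral.integral_const_mul, intervalIntegral.integral_const_mul,
    integral_cos_int_mul, integral_cos_int_mul]
  split_ifs <;> first | omega | ring

lemma integral_sin_mul_sin (i j : ℕ) :
    ∫ θ in (0:ℝ)..Real.pi, Real.sin ((i + 1) * θ) * Real.sin ((j + 1) * θ) =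
      if i = j then Real.pi / 2 else 0 := by
  have h : ∀ θ : ℝ, Real.sin ((i + 1) * θ) * Real.sin ((j + 1) * θ) =
      (1 / 2) * Real.cos (((i:ℤ) - (j:ℤ) : ℤ) * θ) -
      (1 / 2) * Real.cos (((i:ℤ) + (j:ℤ) + 2 : ℤ) * θ) := by
    intro θ
    have e1 : (((i:ℤ) - (j:ℤ) : ℤ) : ℝ) * θ = (i + 1) * θ - (j + 1) * θ := by push_cast; ring
    have e2 : (((i:ℤ) + (j:ℤ) + 2 : ℤ) : ℝ) * θ = (i + 1) * θ + (j + 1) * θ := by push_cast; ring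
    rw [e1, e2, Real.cos_sub, Real.cos_add]
    ring
  simp_rw [h]
  rw [intervalIntegral.integral_sub (by apply Continuous.intervalIntegrable; fun_prop)
    (by apply Continuous.intervalIntegrable; fun_prop), intervalIntegral.integral_const_mul, intervalIntegral.integral_const_mul,
    integral_cos_int_mul, integral_cos_int_mul]
  split_ifs <;> first | omega | ring

/-- Pythagoras for a finite combination of an orthogonal family on `[a, b]`. -/
lemma integral_sum_mul_sq {a b : ℝ} (s : Finset ℕ) (c : ℕ → ℝ) (f : ℕ → ℝ → ℝ)
    (hf : ∀ i, Continuous (f i)) (w : ℕ → ℝ)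
    (h : ∀ i j, ∫ θ in a..b, f i θ * f j θ = if i = j then w i else 0) :
    ∫ θ in a..b, (∑ i ∈ s, c i * f i θ) ^ 2 = ∑ i ∈ s, c i ^ 2 * w i := by
  have e : ∀ θ, (∑ i ∈ s, c i * f i θ) ^ 2 =
      ∑ i ∈ s, ∑ j ∈ s, (c i * c j) * (f i θ * f j θ) := by
    intro θ
    rw [sq, Finset.sum_mul_sum]
    refine Finset.sum_congr rfl fun i _ => Finset.sum_congr rfl fun j _ => by ring
  simp_rw [e]
  rw [intervalIntegral.integral_finsetSum fun i _ => by
    apply Continuous.intervalIntegrable; fun_prop]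
  refine Finset.sum_congr rfl fun i hi => ?_
  rw [intervalIntegral.integral_finsetSum fun j _ => by
    apply Continuous.intervalIntegrable; fun_prop]
  simp_rw [intervalIntegral.integral_const_mul, h]
  simp [hi, sq]

/-- Every polynomial is a combination of Chebyshev polynomials of the second kind. -/
lemma exists_eq_sum_chebyshevU (m : ℕ) : ∀ q : ℝ[X], q.natDegree ≤ m →
    ∃ c : ℕ → ℝ, q = ∑ j ∈ Finset.range (m + 1), C (c j) * Chebyshev.U ℝ j := by
  induction m with
  | zero =>
    intro q hq
    refine ⟨fun _ => q.coeff 0, ?_⟩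
    simpa using eq_C_of_natDegree_le_zero hq
  | succ m ih =>
    intro q hq
    set a : ℝ := q.coeff (m + 1) / (Chebyshev.U ℝ (m + 1 : ℕ)).leadingCoeff with ha
    have hU : (Chebyshev.U ℝ (m + 1 : ℕ)).natDegree = m + 1 := Chebyshev.natDegree_U_natCast ℝ _
    have hU0 : (Chebyshev.U ℝ (m + 1 : ℕ)).leadingCoeff ≠ 0 := by
      intro h0
      rw [leadingCoeff_eq_zero] at h0
      rw [h0] at hU
      simp at hU
    have hd : (q - C a * Chebyshev.U ℝ (m + 1 : ℕ)).natDegree ≤ m := by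
      rw [natDegree_le_iff_coeff_eq_zero]
      intro N hN
      rcases eq_or_lt_of_le (Nat.succ_le_of_lt hN) with h | h
      · rw [← h, coeff_sub, coeff_C_mul]
        have : (Chebyshev.U ℝ (m + 1 : ℕ)).coeff (m + 1) =
            (Chebyshev.U ℝ (m + 1 : ℕ)).leadingCoeff := by rw [leadingCoeff, hU]
        rw [Nat.succ_eq_add_one, this, ha, div_mul_cancel₀ _ hU0, sub_self]
      · rw [coeff_sub, coeff_C_mul, coeff_eq_zero_of_natDegree_lt (lt_of_le_of_lt hq h),
          coeff_eq_zero_of_natDegree_lt (lt_of_eq_of_lt hU h)]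
        simp
    obtain ⟨c, hc⟩ := ih _ hd
    refine ⟨fun j => if j = m + 1 then a else c j, ?_⟩
    simp only [Finset.sum_range_succ _ (m + 1), if_pos]
    rw [← sub_eq_iff_eq_add, hc]
    refine Finset.sum_congr rfl fun j hj => ?_
    rw [if_neg (by have := Finset.mem_range.mp hj; omega)]

/-- Christoffel-type bound for the Chebyshev weight of the second kind. -/
lemma sq_eval_le_sum_chebyshevU {m : ℕ} {q : ℝ[X]} (hq : q.natDegree ≤ m) (t : ℝ) :
    q.eval t ^ 2 ≤ (∑ j ∈ Finset.range (m + 1), (Chebyshev.U ℝ j).eval t ^ 2) *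
      (2 / Real.pi * ∫ θ in (0:ℝ)..Real.pi, (q.eval (Real.cos θ) * Real.sin θ) ^ 2) := by
  obtain ⟨c, hc⟩ := exists_eq_sum_chebyshevU m q hq
  have h1 : ∀ θ : ℝ, q.eval (Real.cos θ) * Real.sin θ =
      ∑ j ∈ Finset.range (m + 1), c j * Real.sin ((j + 1) * θ) := by
    intro θ
    rw [hc, eval_finsetSum, Finset.sum_mul]
    refine Finset.sum_congr rfl fun j _ => ?_
    have := Chebyshev.U_real_cos θ (j : ℤ)
    push_cast at this
    rw [eval_mul, eval_C, mul_assoc, this]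
  simp_rw [h1]
  rw [integral_sum_mul_sq (Finset.range (m + 1)) c (fun j θ => Real.sin ((j + 1) * θ))
    (fun i => by fun_prop) (fun _ => Real.pi / 2) integral_sin_mul_sin]
  have h2 : q.eval t = ∑ j ∈ Finset.range (m + 1), c j * (Chebyshev.U ℝ j).eval t := by
    conv_lhs => rw [hc]
    simp [eval_finsetSum]
  rw [h2, ← Finset.sum_mul]
  have h3 := Finset.sum_mul_sq_le_sq_mul_sq (Finset.range (m + 1)) c
    (fun j => (Chebyshev.U ℝ j).eval t)
  have h4 : 2 / Real.pi * ((∑ j ∈ Finset.range (m + 1), c j ^ 2) * (Real.pi / 2)) =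
      ∑ j ∈ Finset.range (m + 1), c j ^ 2 := by
    field_simp
  rw [h4, mul_comm]
  exact h3

lemma abs_eval_chebyshevU_le (k : ℕ) {t : ℝ} (ht : |t| ≤ 1) :
    |(Chebyshev.U ℝ k).eval t| ≤ k + 1 := by
  induction k with
  | zero => simp
  | succ k ih =>
    have h := Chebyshev.U_eq_X_mul_U_add_T ℝ (k : ℤ)
    push_cast
    rw [h, eval_add, eval_mul, eval_X]
    have h1 := Polynomial.Chebyshev.abs_eval_T_real_le_one ((k : ℤ) + 1) ht
    calc _ ≤ |t * (Chebyshev.U ℝ k).eval t| + |(Chebyshev.T ℝ ((k : ℤ) + 1)).eval t| :=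
          abs_add_le _ _
      _ ≤ (k + 1) + 1 := by
          refine add_le_add ?_ h1
          rw [abs_mul]
          nlinarith [abs_nonneg t, abs_nonneg ((Chebyshev.U ℝ k).eval t)]

/-- Substitution `t = cos θ`. -/
lemma integral_eq_integral_cos_mul_sin {f : ℝ → ℝ} (hf : Continuous f) :
    ∫ t in (-1:ℝ)..1, f t = ∫ θ in (0:ℝ)..Real.pi, f (Real.cos θ) * Real.sin θ := by
  have h := intervalIntegral.integral_comp_mul_deriv' (a := 0) (b := Real.pi) (f := Real.cos)
    (f' := fun θ => - Real.sin θ) (g := f) (fun x _ => Real.hasDerivAt_cos x)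
    (by fun_prop) (by fun_prop)
  rw [Real.cos_zero, Real.cos_pi] at h
  rw [intervalIntegral.integral_symm 1 (-1), ← h, ← intervalIntegral.integral_neg]
  simp

/-- A localised factor: a Chebyshev polynomial of the second kind comparable to its maximum. -/
lemma exists_large_chebyshevU {t η : ℝ} (ht : t ∈ Icc (-1:ℝ) 1) (hη : 0 < η)
    (h : 1 - t ≤ η ^ 2) :
    ∃ k : ℕ, (k : ℝ) ≤ 1 / (4 * η) ∧ 1 ≤ 8 * (k + 1) * η ∧
      ((k : ℝ) + 1) / 2 ≤ |(Chebyshev.U ℝ k).eval t| := by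
  rcases lt_or_ge (1 / (4 * η)) 1 with h1 | h1
  · refine ⟨0, by simp; positivity, ?_, by norm_num⟩
    rw [div_lt_one (by positivity)] at h1
    norm_num
    linarith
  · obtain ⟨k, hk⟩ : ∃ k, ⌊1 / (4 * η)⌋₊ = k + 1 :=
      Nat.exists_eq_succ_of_ne_zero (Nat.floor_pos.mpr h1).ne'
    have hle : ((k : ℝ) + 1) ≤ 1 / (4 * η) := by
      have := Nat.floor_le (a := 1 / (4 * η)) (by positivity)
      rw [hk] at this
      exact_mod_cast this
    have hlt : 1 / (4 * η) < (k : ℝ) + 1 + 1 := by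
      have := Nat.lt_floor_add_one (1 / (4 * η))
      rw [hk] at this
      exact_mod_cast this
    have hk0 : (0:ℝ) ≤ k := Nat.cast_nonneg k
    rw [le_div_iff₀ (by positivity)] at hle
    rw [div_lt_iff₀ (by positivity)] at hlt
    refine ⟨k, ?_, by nlinarith, ?_⟩
    · rw [le_div_iff₀ (by positivity)]
      nlinarith
    · set θ := Real.arccos t with hθ
      have hcos : Real.cos θ = t := Real.cos_arccos ht.1 ht.2
      have h0 : 0 ≤ θ := Real.arccos_nonneg t
      have hpi : θ ≤ Real.pi := Real.arccos_le_pi t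
      have hpi0 := Real.pi_pos
      have hsq : 1 - t = 2 * Real.sin (θ / 2) ^ 2 := by
        rw [← hcos, Real.sin_sq, Real.cos_sq]
        ring_nf
      have hs := Real.mul_le_sin (x := θ / 2) (by linarith) (by linarith)
      have hs2 : θ / Real.pi ≤ Real.sin (θ / 2) := by
        convert hs using 1
        field_simp
      have hs3 : θ / Real.pi ≤ η := by
        have : 0 ≤ θ / Real.pi := by positivity
        nlinarith
      rw [div_le_iff₀ hpi0] at hs3
      have hKθ : ((k:ℝ) + 1) * θ ≤ Real.pi / 2 := by
        nlinarith
      have hθ2 : θ ≤ Real.pi / 2 := by nlinarith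
      rcases h0.eq_or_lt with h0 | h0
      · rw [← h0, Real.cos_zero] at hcos
        rw [← hcos, Chebyshev.U_eval_one]
        push_cast
        rw [abs_of_nonneg (by positivity)]
        linarith
      · have hsin : 0 < Real.sin θ := Real.sin_pos_of_pos_of_lt_pi h0 (by linarith)
        have hU := Chebyshev.U_real_cos θ (k : ℤ)
        push_cast at hU
        rw [hcos] at hU
        have hb := Real.mul_le_sin (x := ((k:ℝ) + 1) * θ) (by positivity) hKθ
        have hlt := Real.sin_le h0.le
        have hp : (1:ℝ) / 2 ≤ 2 / Real.pi := by
          rw [div_le_div_iff₀ (by norm_num) hpi0]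
          linarith [Real.pi_le_four]
        refine le_trans ?_ (le_abs_self _)
        refine le_of_mul_le_mul_right ?_ hsin
        rw [hU]
        calc ((k:ℝ) + 1) / 2 * Real.sin θ ≤ ((k:ℝ) + 1) / 2 * θ := by gcongr
          _ = 1 / 2 * (((k:ℝ) + 1) * θ) := by ring
          _ ≤ 2 / Real.pi * (((k:ℝ) + 1) * θ) := by gcongr
          _ ≤ _ := hb

/-- Pointwise bound for a polynomial by its `L²` norm on `[-1, 1]`. -/
lemma sq_eval_mul_sqrt_le {m : ℕ} (hm : 1 ≤ m) {q : ℝ[X]} (hq : q.natDegree ≤ m) {t : ℝ}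
    (ht : t ∈ Icc (-1/2:ℝ) 1) :
    q.eval t ^ 2 * √(1 - t) ≤ 864 * m * ∫ s in (-1:ℝ)..1, q.eval s ^ 2 := by
  have hm' : (1:ℝ) ≤ m := by exact_mod_cast hm
  set I := ∫ s in (-1:ℝ)..1, q.eval s ^ 2 with hI
  have hI0 : 0 ≤ I := intervalIntegral.integral_nonneg (by norm_num) fun _ _ => sq_nonneg _
  set η := max (√(1 - t)) (1 / m) with hη
  have hη0 : 0 < η := lt_of_lt_of_le (by positivity) (le_max_right _ _)
  have hηm : 1 ≤ η * m := by
    have := le_max_right (√(1 - t)) (1 / (m:ℝ))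
    rwa [div_le_iff₀ (by positivity)] at this
  have hηt : √(1 - t) ≤ η := le_max_left _ _
  have ht1 : t ∈ Icc (-1:ℝ) 1 := ⟨by linarith [ht.1], ht.2⟩
  have htabs : |t| ≤ 1 := abs_le.mpr ht1
  obtain ⟨k, hk1, hk2, hk3⟩ := exists_large_chebyshevU ht1 hη0
    ((Real.sqrt_le_left hη0.le).mp hηt)
  have hkm : (k : ℝ) ≤ m := by
    refine hk1.trans ?_
    rw [div_le_iff₀ (by positivity)]
    nlinarith
  have hdeg : (q * Chebyshev.U ℝ k).natDegree ≤ m + k :=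
    natDegree_mul_le.trans (add_le_add hq (Chebyshev.natDegree_U_natCast ℝ k).le)
  have main := sq_eval_le_sum_chebyshevU hdeg t
  have h_integral : ∫ θ in (0:ℝ)..Real.pi, ((q * Chebyshev.U ℝ k).eval (Real.cos θ) * Real.sin θ) ^ 2
      ≤ (k + 1) * I := by
    rw [hI, integral_eq_integral_cos_mul_sin (f := fun s => q.eval s ^ 2) (by fun_prop),
      ← intervalIntegral.integral_const_mul]
    refine intervalIntegral.integral_mono_on Real.pi_pos.le (by apply Continuous.intervalIntegrable; fun_prop)
      (by apply Continuous.intervalIntegrable; fun_prop) fun θ hθ => ?_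
    have hs := Real.sin_nonneg_of_mem_Icc hθ
    have h1 := abs_eval_chebyshevU_le k (Real.abs_cos_le_one θ)
    have h2 : |(Chebyshev.U ℝ k).eval (Real.cos θ) * Real.sin θ| ≤ 1 := by
      rw [Chebyshev.U_real_cos]
      exact Real.abs_sin_le_one _
    rw [eval_mul]
    have h3 : ((Chebyshev.U ℝ k).eval (Real.cos θ)) ^ 2 * Real.sin θ ^ 2 ≤
        (k + 1) * Real.sin θ := by
      rw [← mul_pow, ← sq_abs, sq]
      calc _ ≤ |(Chebyshev.U ℝ k).eval (Real.cos θ) * Real.sin θ| * 1 := by gcongr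
        _ = |(Chebyshev.U ℝ k).eval (Real.cos θ)| * Real.sin θ := by
          rw [abs_mul, abs_of_nonneg hs, mul_one]
        _ ≤ _ := by gcongr
    calc _ = q.eval (Real.cos θ) ^ 2 *
          (((Chebyshev.U ℝ k).eval (Real.cos θ)) ^ 2 * Real.sin θ ^ 2) := by ring
      _ ≤ q.eval (Real.cos θ) ^ 2 * ((k + 1) * Real.sin θ) := by gcongr
      _ = _ := by ring
  have hW : ∀ j ∈ Finset.range (m + k + 1),
      (Chebyshev.U ℝ j).eval t ^ 2 * η ^ 2 ≤ 9 := by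
    intro j hj
    have hj' : (j : ℝ) + 1 ≤ 3 * m := by
      have : (j : ℝ) + 1 ≤ m + k + 1 := by
        have := Finset.mem_range.mp hj
        exact_mod_cast this
      linarith
    rcases max_choice (√(1 - t)) (1 / (m:ℝ)) with hc | hc
    · rw [hη, hc, Real.sq_sqrt (by linarith [ht.2])]
      have h2 := Chebyshev.U_real_cos (Real.arccos t) (j : ℤ)
      rw [Real.cos_arccos ht1.1 ht1.2, Real.sin_arccos] at h2
      have h3 : ((Chebyshev.U ℝ j).eval t * √(1 - t ^ 2)) ^ 2 ≤ 1 := by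
        rw [h2]
        exact Real.sin_sq_le_one _
      rw [mul_pow, Real.sq_sqrt (by nlinarith [ht1.1, ht1.2])] at h3
      have h4 : 0 ≤ (Chebyshev.U ℝ j).eval t ^ 2 * (1 - t) := by
        have := ht.2
        have : 0 ≤ 1 - t := by linarith
        positivity
      nlinarith [ht.1]
    · rw [hη, hc]
      have h1 := abs_eval_chebyshevU_le j htabs
      have h2 : (Chebyshev.U ℝ j).eval t ^ 2 ≤ (3 * m) ^ 2 := by
        rw [← sq_abs]
        gcongr
        linarith
      calc _ ≤ (3 * (m:ℝ)) ^ 2 * (1 / m) ^ 2 := by gcongr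
        _ = 9 := by field_simp; norm_num
  have hsum : (∑ j ∈ Finset.range (m + k + 1), (Chebyshev.U ℝ j).eval t ^ 2) * η ^ 2 ≤
      27 * m := by
    rw [Finset.sum_mul]
    refine (Finset.sum_le_card_nsmul _ _ _ hW).trans ?_
    simp only [Finset.card_range, nsmul_eq_mul]
    push_cast
    nlinarith
  have hU2 : (((k:ℝ) + 1) / 2) ^ 2 ≤ (Chebyshev.U ℝ k).eval t ^ 2 := by
    rw [← sq_abs ((Chebyshev.U ℝ k).eval t)]
    gcongr
  have hpi : 2 / Real.pi ≤ 1 := by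
    rw [div_le_one Real.pi_pos]
    exact Real.two_le_pi
  rw [eval_mul, mul_pow] at main
  have h5 : q.eval t ^ 2 * (((k:ℝ) + 1) / 2) ^ 2 * η ^ 2 ≤ 27 * m * ((k + 1) * I) := by
    calc _ ≤ q.eval t ^ 2 * (Chebyshev.U ℝ k).eval t ^ 2 * η ^ 2 := by gcongr
      _ ≤ (∑ j ∈ Finset.range (m + k + 1), (Chebyshev.U ℝ j).eval t ^ 2) *
          (1 * ((k + 1) * I)) * η ^ 2 := by
        refine mul_le_mul_of_nonneg_right (main.trans ?_) (sq_nonneg η)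
        refine mul_le_mul_of_nonneg_left ?_ (Finset.sum_nonneg fun _ _ => sq_nonneg _)
        refine mul_le_mul hpi h_integral ?_ zero_le_one
        exact intervalIntegral.integral_nonneg Real.pi_pos.le fun _ _ => sq_nonneg _
      _ = ((∑ j ∈ Finset.range (m + k + 1), (Chebyshev.U ℝ j).eval t ^ 2) * η ^ 2) *
          ((k + 1) * I) := by ring
      _ ≤ _ := by gcongr
  have h6 : q.eval t ^ 2 * ((k:ℝ) + 1) * η ^ 2 ≤ 108 * m * I := by
    refine le_of_mul_le_mul_right ?_ (show (0:ℝ) < (k:ℝ) + 1 by positivity)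
    nlinarith
  calc q.eval t ^ 2 * √(1 - t) ≤ q.eval t ^ 2 * η * 1 := by rw [mul_one]; gcongr
    _ ≤ q.eval t ^ 2 * η * (8 * (k + 1) * η) := by gcongr
    _ = 8 * (q.eval t ^ 2 * ((k:ℝ) + 1) * η ^ 2) := by ring
    _ ≤ 8 * (108 * m * I) := by gcongr
    _ = _ := by ring

lemma le_sum_sq_eval_chebyshevT (M : ℕ) (t : ℝ) :
    1 + 7 / 32 * (M : ℝ) ≤
      ∑ j ∈ Finset.range (2 * M + 1), (Chebyshev.T ℝ j).eval t ^ 2 := by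
  set f : ℕ → ℝ := fun j => (Chebyshev.T ℝ j).eval t ^ 2 with hf
  have hpair : ∀ j : ℕ, 7 / 16 ≤ f j + f (2 * j) := by
    intro j
    have h : (Chebyshev.T ℝ ((2 * j : ℕ) : ℤ)).eval t = 2 * (Chebyshev.T ℝ j).eval t ^ 2 - 1 := by
      have := congrArg (eval t) (Chebyshev.T_mul_T ℝ (j : ℤ) (j : ℤ))
      simp only [eval_mul, eval_add, sub_self, Chebyshev.T_zero, eval_one, eval_ofNat] at this
      have e : ((2 * j : ℕ) : ℤ) = (j : ℤ) + j := by push_cast; ring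
      rw [e]
      linarith
    simp only [hf, h]
    nlinarith [sq_nonneg ((Chebyshev.T ℝ j).eval t ^ 2 - 3 / 8)]
  have hnn : ∀ j, 0 ≤ f j := fun j => sq_nonneg _
  rw [Finset.sum_range_succ']
  have h0 : f 0 = 1 := by simp [hf]
  rw [show (Chebyshev.T ℝ ((0:ℕ):ℤ)).eval t ^ 2 = 1 from h0]
  have h1 : ∑ j ∈ Finset.range M, f (j + 1) ≤ ∑ j ∈ Finset.range (2 * M), f (j + 1) :=
    Finset.sum_le_sum_of_subset_of_nonneg
      (Finset.range_subset_range.mpr (by omega)) fun _ _ _ => hnn _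
  have h2 : ∑ j ∈ Finset.range M, f (2 * (j + 1)) ≤ ∑ j ∈ Finset.range (2 * M), f (j + 1) := by
    have e : ∀ j ∈ Finset.range M, f (2 * (j + 1)) = f ((2 * j + 1) + 1) := fun j _ => rfl
    rw [Finset.sum_congr rfl e,
      ← Finset.sum_image (s := Finset.range M) (g := fun j => 2 * j + 1) (f := fun i => f (i + 1))
        (fun a _ b _ hab => by simpa using hab)]
    refine Finset.sum_le_sum_of_subset_of_nonneg ?_ fun _ _ _ => hnn _
    intro i hi
    simp only [Finset.mem_image, Finset.mem_range] at hi ⊢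
    omega
  have h3 : (M : ℝ) * (7 / 16) ≤ ∑ j ∈ Finset.range M, (f (j + 1) + f (2 * (j + 1))) := by
    have := Finset.card_nsmul_le_sum (Finset.range M)
      (fun j => f (j + 1) + f (2 * (j + 1))) (7 / 16) fun j _ => hpair _
    simpa using this
  rw [Finset.sum_add_distrib] at h3
  change _ ≤ ∑ j ∈ Finset.range (2 * M), f (j + 1) + 1
  linarith

/-- Peaking polynomials on `[-1, 1]`. -/
lemma exists_peak_polynomial {n : ℕ} (hn : 1 ≤ n) {t η : ℝ} (ht : t ∈ Icc (-1:ℝ) 1)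
    (hη : 1 / (n:ℝ) ≤ η) (h : 1 - t ≤ η ^ 2) :
    ∃ P : ℝ[X], P.natDegree ≤ n / 2 ∧ P.eval t = 1 ∧
      ∫ s in (-1:ℝ)..1, P.eval s ^ 2 ≤ 8192 * η / n := by
  have hn' : (1:ℝ) ≤ n := by exact_mod_cast hn
  have hη0 : 0 < η := lt_of_lt_of_le (by positivity) hη
  have hηn : 1 ≤ η * n := by rwa [div_le_iff₀ (by positivity)] at hη
  obtain ⟨k, hk1, hk2, hk3⟩ := exists_large_chebyshevU ht hη0 h
  have hkn : k ≤ n / 4 := by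
    rw [Nat.le_div_iff_mul_le (by norm_num)]
    rw [le_div_iff₀ (by positivity)] at hk1
    have : (k:ℝ) * 4 ≤ n := by
      refine le_of_mul_le_mul_right ?_ hη0
      linarith
    exact_mod_cast this
  set M := n / 8 with hM
  set S := ∑ j ∈ Finset.range (2 * M + 1), (Chebyshev.T ℝ j).eval t ^ 2 with hS
  have hSn : (n:ℝ) / 64 ≤ S := by
    refine le_trans ?_ (le_sum_sq_eval_chebyshevT M t)
    have : n < 8 * (M + 1) := by omega
    have : (n:ℝ) < 8 * (M + 1) := by exact_mod_cast this
    linarith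
  have hS0 : 0 < S := lt_of_lt_of_le (by positivity) hSn
  set Q : ℝ[X] := ∑ j ∈ Finset.range (2 * M + 1), C ((Chebyshev.T ℝ j).eval t) * Chebyshev.T ℝ j
    with hQ
  set u := (Chebyshev.U ℝ k).eval t with hu
  have hu0 : u ≠ 0 := by
    have : 0 < |u| := lt_of_lt_of_le (by positivity) hk3
    exact abs_pos.mp this
  have hQt : Q.eval t = S := by
    rw [hQ, hS, eval_finsetSum]
    refine Finset.sum_congr rfl fun j _ => ?_
    rw [eval_mul, eval_C, sq]
  have hQdeg : Q.natDegree ≤ 2 * M := by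
    refine natDegree_sum_le_of_forall_le _ _ fun j hj => ?_
    refine (natDegree_C_mul_le _ _).trans ?_
    rw [Chebyshev.natDegree_T]
    have := Finset.mem_range.mp hj
    simp
    omega
  refine ⟨C (1 / (S * u)) * (Q * Chebyshev.U ℝ k), ?_, ?_, ?_⟩
  · refine (natDegree_C_mul_le _ _).trans (natDegree_mul_le.trans ?_)
    rw [Chebyshev.natDegree_U_natCast]
    omega
  · rw [eval_mul, eval_mul, eval_C, hQt, ← hu]
    field_simp
  · have hQint : ∫ θ in (0:ℝ)..Real.pi, Q.eval (Real.cos θ) ^ 2 ≤ Real.pi * S := by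
      have e : ∀ θ : ℝ, Q.eval (Real.cos θ) = ∑ j ∈ Finset.range (2 * M + 1),
          (Chebyshev.T ℝ j).eval t * Real.cos (j * θ) := by
        intro θ
        rw [hQ, eval_finsetSum]
        refine Finset.sum_congr rfl fun j _ => ?_
        rw [eval_mul, eval_C, Chebyshev.T_real_cos]
        simp
      simp_rw [e]
      rw [integral_sum_mul_sq (Finset.range (2 * M + 1)) (fun j => (Chebyshev.T ℝ j).eval t)
        (fun j θ => Real.cos (j * θ)) (fun i => by fun_prop)
        (fun i => if i = 0 then Real.pi else Real.pi / 2) integral_cos_mul_cos, hS, Finset.mul_sum]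
      refine Finset.sum_le_sum fun j _ => ?_
      rw [mul_comm]
      refine mul_le_mul_of_nonneg_right ?_ (sq_nonneg _)
      split_ifs <;> linarith [Real.pi_pos]
    have h_integral : ∫ s in (-1:ℝ)..1, (Q * Chebyshev.U ℝ k).eval s ^ 2 ≤ (k + 1) * (Real.pi * S) := by
      rw [integral_eq_integral_cos_mul_sin (f := fun s => (Q * Chebyshev.U ℝ k).eval s ^ 2)
        (by fun_prop)]
      refine le_trans ?_ (mul_le_mul_of_nonneg_left hQint (by positivity))
      rw [← intervalIntegral.integral_const_mul]
      refine intervalIntegral.integral_mono_on Real.pi_pos.le (by apply Continuous.intervalIntegrable; fun_prop)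
        (by apply Continuous.intervalIntegrable; fun_prop) fun θ hθ => ?_
      have hs := Real.sin_nonneg_of_mem_Icc hθ
      have h1 := abs_eval_chebyshevU_le k (Real.abs_cos_le_one θ)
      have h2 : |(Chebyshev.U ℝ k).eval (Real.cos θ) * Real.sin θ| ≤ 1 := by
        rw [Chebyshev.U_real_cos]
        exact Real.abs_sin_le_one _
      rw [abs_mul, abs_of_nonneg hs] at h2
      have h3 : ((Chebyshev.U ℝ k).eval (Real.cos θ)) ^ 2 * Real.sin θ ≤ k + 1 := by
        rw [← sq_abs, sq, mul_assoc]
        calc _ ≤ ((k:ℝ) + 1) * 1 := by gcongr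
          _ = _ := by ring
      rw [eval_mul]
      calc _ = Q.eval (Real.cos θ) ^ 2 *
            (((Chebyshev.U ℝ k).eval (Real.cos θ)) ^ 2 * Real.sin θ) := by ring
        _ ≤ Q.eval (Real.cos θ) ^ 2 * (k + 1) := by gcongr
        _ = _ := by ring
    have e : ∀ s : ℝ, (C (1 / (S * u)) * (Q * Chebyshev.U ℝ k)).eval s ^ 2 =
        (1 / (S * u)) ^ 2 * (Q * Chebyshev.U ℝ k).eval s ^ 2 := by
      intro s
      rw [eval_mul, eval_C, mul_pow]
    simp_rw [e]
    rw [intervalIntegral.integral_const_mul]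
    have hU2 : (((k:ℝ) + 1) / 2) ^ 2 ≤ u ^ 2 := by
      rw [← sq_abs u]
      gcongr
    have hu2 : 0 < u ^ 2 := by positivity
    calc (1 / (S * u)) ^ 2 * ∫ s in (-1:ℝ)..1, (Q * Chebyshev.U ℝ k).eval s ^ 2
        ≤ (1 / (S * u)) ^ 2 * ((k + 1) * (Real.pi * S)) := by gcongr
      _ = (k + 1) * Real.pi / (S * u ^ 2) := by field_simp
      _ ≤ (k + 1) * 4 / (n / 64 * (((k:ℝ) + 1) / 2) ^ 2) := by
        gcongr
        exact Real.pi_le_four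
      _ = 1024 / n * (1 / (k + 1)) := by field_simp; norm_num
      _ ≤ 1024 / n * (8 * η) := by
        gcongr
        rw [div_le_iff₀ (by positivity)]
        linarith
      _ = _ := by ring

/-- Growth of a bounded polynomial just outside `[-1, 1]`. -/
lemma abs_eval_le_two_mul {n : ℕ} (hn : 1 ≤ n) {q : ℝ[X]} (hq : q.natDegree ≤ n) {M : ℝ}
    (hM : ∀ t ∈ Icc (-1:ℝ) 1, |q.eval t| ≤ M) {x : ℝ} (hx : 1 ≤ x)
    (hx2 : x ≤ 1 + 1 / (2 * (n:ℝ) ^ 2)) : |q.eval x| ≤ 2 * M := by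
  have hn' : (1:ℝ) ≤ n := by exact_mod_cast hn
  have hT : (Chebyshev.T ℝ n).eval x ≤ 2 := by
    set a := Real.arcosh x with ha
    have ha0 : 0 ≤ a := Real.arcosh_nonneg hx
    have hax : Real.cosh a = x := Real.cosh_arcosh hx
    have h1 : 1 + a ^ 2 / 2 ≤ x := by
      rw [← hax]
      have e := Real.cosh_two_mul (a / 2)
      have e' := Real.cosh_sq (a / 2)
      rw [mul_div_cancel₀ a two_ne_zero] at e
      have := Real.self_le_sinh_iff.mpr (show 0 ≤ a / 2 by positivity)
      nlinarith
    have h2 : n * a ≤ 1 := by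
      have h3 : a ^ 2 ≤ 1 / (n:ℝ) ^ 2 := by
        have e : 1 / (2 * (n:ℝ) ^ 2) = 1 / (n:ℝ) ^ 2 / 2 := by field_simp
        linarith
      rw [le_div_iff₀ (by positivity)] at h3
      nlinarith [mul_nonneg (Nat.cast_nonneg (α := ℝ) n) ha0]
    rw [← hax, Chebyshev.T_real_cosh]
    push_cast
    have h4 : Real.cosh (n * a) ≤ Real.cosh 1 := by
      rw [Real.cosh_le_cosh, abs_of_nonneg (by positivity)]
      simpa using h2
    have h5 : Real.cosh 1 ≤ 2 := by
      rw [Real.cosh_eq]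
      have := Real.exp_one_lt_d9
      have h6 : Real.exp (-1) ≤ 1 := Real.exp_le_one_iff.mpr (by norm_num)
      linarith
    linarith
  have key : ∀ p : ℝ[X], p.natDegree ≤ n → (∀ t ∈ Icc (-1:ℝ) 1, |p.eval t| ≤ 1) →
      p.eval x ≤ 2 := fun p hp hb =>
    (Polynomial.Chebyshev.eval_iterate_derivative_le_of_forall_abs_le_one (k := 0) hx
      (natDegree_le_iff_degree_le.mp hp) hb).trans hT
  have hM0 : 0 ≤ M := (abs_nonneg _).trans (hM 0 (by norm_num))
  have key2 : ∀ ε : ℝ, 0 < ε → |q.eval x| ≤ 2 * (M + ε) := by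
    intro ε hε
    have hpos : 0 < M + ε := by linarith
    have hb : ∀ σ : ℝ, |σ| = 1 → σ * q.eval x ≤ 2 * (M + ε) := by
      intro σ hσ
      have := key (C (σ / (M + ε)) * q) ((natDegree_C_mul_le _ _).trans hq) (by
        intro t ht
        rw [eval_mul, eval_C, abs_mul, abs_div, hσ, abs_of_pos hpos, div_mul_eq_mul_div, one_mul,
          div_le_one hpos]
        linarith [hM t ht])
      rw [eval_mul, eval_C, div_mul_eq_mul_div, div_le_iff₀ hpos] at this
      exact this
    rw [abs_le]
    constructor
    · linarith [hb (-1) (by simp)]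
    · linarith [hb 1 (by simp)]
  refine le_of_forall_pos_le_add fun ε hε => ?_
  have := key2 (ε / 2) (by linarith)
  linarith

end OneVariable

section AffineMaps

lemma e2_apply_zero (a b : ℝ) : e2 a b 0 = a := rfl

lemma e2_apply_one (a b : ℝ) : e2 a b 1 = b := rfl

lemma e2_ext {z w : E2} (h0 : z 0 = w 0) (h1 : z 1 = w 1) : z = w := by
  ext i
  fin_cases i
  · exact h0
  · exact h1

lemma norm_sq_eq_coords (z : E2) : ‖z‖ ^ 2 = z 0 ^ 2 + z 1 ^ 2 := by
  rw [EuclideanSpace.norm_sq_eq, Fin.sum_univ_two]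
  simp

lemma norm_le_one_iff (z : E2) : ‖z‖ ≤ 1 ↔ z 0 ^ 2 + z 1 ^ 2 ≤ 1 := by
  rw [← norm_sq_eq_coords, sq_le_one_iff₀ (norm_nonneg z)]

/-- The affine automorphism of the plane with given invertible matrix and translation. -/
lemma exists_affineEquiv (a b c d p q : ℝ) (h : a * d - b * c ≠ 0) :
    ∃ T : E2 ≃ᵃ[ℝ] E2, (∀ z, T z 0 = a * z 0 + b * z 1 + p) ∧
      (∀ z, T z 1 = c * z 0 + d * z 1 + q) ∧ adet T = a * d - b * c := by
  let v := (EuclideanSpace.basisFun (Fin 2) ℝ).toBasis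
  let A : E2 →ₗ[ℝ] E2 := Matrix.toLin v v !![a, b; c, d]
  have hdet : LinearMap.det A = a * d - b * c := by
    rw [LinearMap.det_toLin, Matrix.det_fin_two_of]
  let L : E2 ≃ₗ[ℝ] E2 := LinearEquiv.ofIsUnitDet (f := A) (v := v) (v' := v)
    (by rw [LinearMap.toMatrix_toLin, Matrix.det_fin_two_of]; exact h.isUnit)
  have hA : ∀ z, A z = e2 (a * z 0 + b * z 1) (c * z 0 + d * z 1) := by
    intro z
    apply e2_ext <;>
    simp [A, Matrix.toLin_apply, v, Matrix.mulVec, dotProduct, e2_apply_zero, e2_apply_one,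
      Fin.sum_univ_two]
  refine ⟨L.toAffineEquiv.trans (AffineEquiv.constVAdd ℝ E2 (e2 p q)), fun z => ?_, fun z => ?_, ?_⟩
  · have : L z = A z := rfl
    simp [this, hA, e2_apply_zero]
    ring
  · have : L z = A z := rfl
    simp [this, hA, e2_apply_one]
    ring
  · rw [← hdet]
    rfl

/-- Coordinates of an affine automorphism of the plane. -/
lemma exists_coeffs (T : E2 ≃ᵃ[ℝ] E2) :
    ∃ a b c d p q : ℝ, (∀ z, T z 0 = a * z 0 + b * z 1 + p) ∧
      (∀ z, T z 1 = c * z 0 + d * z 1 + q) ∧ adet T = a * d - b * c := by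
  have hT : ∀ z, T z = z 0 • T.linear (e2 1 0) + z 1 • T.linear (e2 0 1) + T 0 := by
    intro z
    have h1 : T z = T.linear z + T 0 := by
      have := T.map_vadd 0 z
      simpa using this
    have h2 : z = z 0 • e2 1 0 + z 1 • e2 0 1 := by
      apply e2_ext <;> simp [e2_apply_zero, e2_apply_one]
    rw [h1]
    conv_lhs => rw [h2]
    simp
  refine ⟨T.linear (e2 1 0) 0, T.linear (e2 0 1) 0, T.linear (e2 1 0) 1, T.linear (e2 0 1) 1,
    T 0 0, T 0 1, fun z => ?_, fun z => ?_, ?_⟩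
  · rw [hT]
    simp
    ring
  · rw [hT]
    simp
    ring
  · let v := (EuclideanSpace.basisFun (Fin 2) ℝ).toBasis
    have e0 : v 0 = e2 1 0 := by apply e2_ext <;> simp [v, e2_apply_zero, e2_apply_one]
    have e1 : v 1 = e2 0 1 := by apply e2_ext <;> simp [v, e2_apply_zero, e2_apply_one]
    rw [adet, ← LinearMap.det_toMatrix v, Matrix.det_fin_two]
    simp only [LinearMap.toMatrix_apply, e0, e1]
    simp [v]

lemma adet_ne_zero (T : E2 ≃ᵃ[ℝ] E2) : adet T ≠ 0 :=
  (LinearEquiv.isUnit_det' T.linear).ne_zero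

lemma adet_symm (T : E2 ≃ᵃ[ℝ] E2) : adet T.symm = (adet T)⁻¹ := by
  refine eq_inv_of_mul_eq_one_left ?_
  rw [adet, adet, ← LinearMap.det_comp]
  have : (T.symm.linear : E2 →ₗ[ℝ] E2) ∘ₗ (T.linear : E2 →ₗ[ℝ] E2) = LinearMap.id := by
    ext z : 1
    simp
  rw [this, LinearMap.det_id]

lemma setIntegral_affineEquiv_image (T : E2 ≃ᵃ[ℝ] E2) {s : Set E2} (hs : MeasurableSet s)
    (f : E2 → ℝ) : ∫ z in T '' s, f z = |adet T| * ∫ z in s, f (T z) := by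
  have hd : ∀ z ∈ s, HasFDerivWithinAt T
      (LinearMap.toContinuousLinearMap (T.linear : E2 →ₗ[ℝ] E2)) s z := by
    intro z _
    have h : (T : E2 → E2) = fun z =>
        LinearMap.toContinuousLinearMap (T.linear : E2 →ₗ[ℝ] E2) z + T 0 := by
      funext z
      have := T.map_vadd 0 z
      simpa using this
    rw [h]
    exact (ContinuousLinearMap.hasFDerivAt _).hasFDerivWithinAt.add_const _
  rw [integral_image_eq_integral_abs_det_fderiv_smul volume hs hd T.injective.injOn f]
  simp_rw [smul_eq_mul]
  rw [integral_const_mul]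
  rfl

lemma measurePreserving_e2 : MeasurePreserving (fun z : ℝ × ℝ => e2 z.1 z.2) := by
  have h := (EuclideanSpace.volume_preserving_symm_measurableEquiv_toLp (Fin 2)).symm.comp
    (volume_preserving_finTwoArrow ℝ).symm
  have e : (fun z : ℝ × ℝ => e2 z.1 z.2) = (MeasurableEquiv.toLp 2 (Fin 2 → ℝ)).symm.symm ∘
      (MeasurableEquiv.finTwoArrow (α := ℝ)).symm := by
    funext z
    apply e2_ext <;> rfl
  rw [e]
  exact h

lemma continuous_e2 : Continuous (fun z : ℝ × ℝ => e2 z.1 z.2) := by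
  have : Continuous fun z : ℝ × ℝ => (![z.1, z.2] : Fin 2 → ℝ) := by
    refine continuous_pi fun i => ?_
    fin_cases i
    · exact continuous_fst
    · exact continuous_snd
  exact (PiLp.continuous_toLp 2 _).comp this

end AffineMaps

section LowerBound

open Polynomial

lemma continuous_eval_coords (p : MvPolynomial (Fin 2) ℝ) :
    Continuous fun z : E2 => MvPolynomial.eval (fun i => z i) p :=
  p.continuous_eval.comp (by fun_prop)

/-- The sheared rectangle `{(t - σ², σ)}` lies in the unit ball, so its integral is a lower bound. -/
lemma integral_shear_le (h : E2 → ℝ) (hc : Continuous h) (h0 : ∀ z, 0 ≤ h z) :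
    ∫ σ in (-1/2:ℝ)..1/2, ∫ t in (-1/2:ℝ)..1, h (e2 (t - σ ^ 2) σ) ≤ ∫ z in ballE, h z := by
  have hshear : MeasurePreserving (fun z : ℝ × ℝ => (z.1, z.2 - z.1 ^ 2)) := by
    refine (MeasurePreserving.id (volume : Measure ℝ)).skew_product
      (g := fun σ t => t - σ ^ 2) (by fun_prop) ?_
    exact Filter.Eventually.of_forall fun σ => (measurePreserving_sub_right volume (σ ^ 2)).map_eq
  have hswap : MeasurePreserving (Prod.swap : ℝ × ℝ → ℝ × ℝ) := Measure.measurePreserving_swap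
  have hΨ := measurePreserving_e2.comp (hswap.comp hshear)
  have hΨc : Continuous fun z : ℝ × ℝ => e2 (z.2 - z.1 ^ 2) z.1 :=
    continuous_e2.comp (by fun_prop : Continuous fun z : ℝ × ℝ => (z.2 - z.1 ^ 2, z.1))
  have hball : MeasurableSet ballE := measurableSet_closedBall
  have h1 : ∫ z in ballE, h z = ∫ z in (fun z : ℝ × ℝ => e2 (z.2 - z.1 ^ 2) z.1) ⁻¹' ballE,
      h (e2 (z.2 - z.1 ^ 2) z.1) := by
    conv_lhs => rw [← hΨ.map_eq]
    rw [setIntegral_map hball (hc.aestronglyMeasurable) hΨ.measurable.aemeasurable]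
    rfl
  rw [h1]
  have hsub : Icc (-1/2:ℝ) (1/2) ×ˢ Icc (-1/2:ℝ) 1 ⊆
      (fun z : ℝ × ℝ => e2 (z.2 - z.1 ^ 2) z.1) ⁻¹' ballE := by
    rintro ⟨σ, t⟩ ⟨⟨h1, h2⟩, h3, h4⟩
    simp only [mem_preimage, ballE, mem_closedBall_zero_iff, norm_le_one_iff, e2_apply_zero,
      e2_apply_one] at *
    have hs : σ ^ 2 ≤ 1 / 4 := by nlinarith
    nlinarith [sq_nonneg σ, mul_nonneg (sub_nonneg.mpr h4) (sq_nonneg σ),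
      mul_nonneg (sub_nonneg.mpr hs) (sq_nonneg σ)]
  have hcont : Continuous fun z : ℝ × ℝ => h (e2 (z.2 - z.1 ^ 2) z.1) := hc.comp hΨc
  have h_integral : IntegrableOn (fun z : ℝ × ℝ => h (e2 (z.2 - z.1 ^ 2) z.1))
      ((fun z : ℝ × ℝ => e2 (z.2 - z.1 ^ 2) z.1) ⁻¹' ballE) := by
    have hi : IntegrableOn h ballE :=
      hc.continuousOn.integrableOn_compact (isCompact_closedBall _ _)
    exact (hΨ.restrict_preimage hball).integrable_comp_of_integrable hi
  refine le_trans (le_of_eq ?_) (setIntegral_mono_set h_integral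
    (Filter.Eventually.of_forall fun z => h0 _) hsub.eventuallyLE)
  rw [Measure.volume_eq_prod, setIntegral_prod _
    (hcont.continuousOn.integrableOn_compact (isCompact_Icc.prod isCompact_Icc))]
  rw [intervalIntegral.integral_of_le (by norm_num), integral_Icc_eq_integral_Ioc]
  refine integral_congr_ae (Filter.Eventually.of_forall fun σ => ?_)
  beta_reduce
  rw [intervalIntegral.integral_of_le (by norm_num), integral_Icc_eq_integral_Ioc]

/-- Restricting a bivariate polynomial to a polynomial curve. -/
lemma exists_polynomial_comp (p : MvPolynomial (Fin 2) ℝ) {n k : ℕ} (hp : p.totalDegree ≤ n)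
    (f g : ℝ[X]) (hf : f.natDegree ≤ k) (hg : g.natDegree ≤ k) :
    ∃ q : ℝ[X], q.natDegree ≤ n * k ∧ ∀ t, q.eval t =
      MvPolynomial.eval ![f.eval t, g.eval t] p := by
  refine ⟨MvPolynomial.aeval ![f, g] p, ?_, fun t => ?_⟩
  · refine MvPolynomial.aeval_natDegree_le p hp _ fun i => ?_
    fin_cases i
    · exact hf
    · exact hg
  · clear hp
    induction p using MvPolynomial.induction_on with
    | C a => simp
    | add p q hp hq => simp [hp, hq]
    | mul_X p i hp => fin_cases i <;> simp [hp]

lemma sq_eval_mul_sqrt_mul_adet_le (T : E2 ≃ᵃ[ℝ] E2) {D : Set E2} (hD : IsCompact D)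
    (hT : T '' ballE ⊆ D) {r : ℝ} (hr0 : 0 ≤ r) (hr1 : r ≤ 1) {n : ℕ} (hn : 1 ≤ n)
    (p : MvPolynomial (Fin 2) ℝ) (hp : p.totalDegree ≤ n) :
    MvPolynomial.eval (fun i => T (e2 r 0) i) p ^ 2 * √(1 - r) * |adet T| ≤
      4000000 * n ^ 2 * ∫ z in D, MvPolynomial.eval (fun i => z i) p ^ 2 := by
  set P : E2 → ℝ := fun z => MvPolynomial.eval (fun i => z i) p with hP
  have hPc : Continuous P := continuous_eval_coords p
  have hTc : Continuous T := T.toContinuousAffineEquiv.continuous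
  have hball : MeasurableSet ballE := measurableSet_closedBall
  have hD1 : |adet T| * ∫ z in ballE, P (T z) ^ 2 ≤ ∫ z in D, P z ^ 2 := by
    rw [← setIntegral_affineEquiv_image T hball (fun z => P z ^ 2)]
    exact setIntegral_mono_set ((hPc.pow 2).continuousOn.integrableOn_compact hD)
      (Filter.Eventually.of_forall fun z => sq_nonneg _) hT.eventuallyLE
  have hsh := integral_shear_le (fun z => P (T z) ^ 2) ((hPc.comp hTc).pow 2)
    fun _ => sq_nonneg _
  obtain ⟨a, b, c, d, u, v, h0, h1, -⟩ := exists_coeffs T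
  have hPT : ∀ z, P (T z) = MvPolynomial.eval
      ![a * z 0 + b * z 1 + u, c * z 0 + d * z 1 + v] p := by
    intro z
    simp only [hP]
    congr 2
    funext i
    fin_cases i
    · exact h0 z
    · exact h1 z
  have hvert : ∀ σ : ℝ, P (T (e2 (r - σ ^ 2) σ)) ^ 2 * √(1 - r) ≤
      1152 * n * ∫ t in (-1/2:ℝ)..1, P (T (e2 (t - σ ^ 2) σ)) ^ 2 := by
    intro σ
    obtain ⟨q, hq, hqe⟩ := exists_polynomial_comp p hp (k := 1)
      (C (a * (3 / 4)) * X + C (a * (1 / 4 - σ ^ 2) + b * σ + u))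
      (C (c * (3 / 4)) * X + C (c * (1 / 4 - σ ^ 2) + d * σ + v))
      (by compute_degree) (by compute_degree)
    have hq' : ∀ ξ, q.eval ξ = P (T (e2 (3 / 4 * ξ + 1 / 4 - σ ^ 2) σ)) := by
      intro ξ
      rw [hqe, hPT]
      simp only [eval_add, eval_mul, eval_C, eval_X, e2_apply_zero, e2_apply_one]
      congr 2
      ring_nf
    have := sq_eval_mul_sqrt_le hn (hq.trans (by simp)) (t := (r - 1 / 4) / (3 / 4))
      ⟨by linarith, by linarith⟩
    simp only [hq'] at this
    rw [show 3 / 4 * ((r - 1 / 4) / (3 / 4)) + 1 / 4 = r by ring] at this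
    have hi := intervalIntegral.integral_comp_mul_add
      (fun t => P (T (e2 (t - σ ^ 2) σ)) ^ 2) (a := -1) (b := 1)
      (show (3 / 4 : ℝ) ≠ 0 by norm_num) (1 / 4)
    norm_num at hi
    norm_num at this ⊢
    rw [hi] at this
    have hs : √(1 - r) ≤ √(1 - (r - 1 / 4) / (3 / 4)) := Real.sqrt_le_sqrt (by linarith)
    have := mul_le_mul_of_nonneg_left hs (sq_nonneg (P (T (e2 (r - σ ^ 2) σ))))
    linarith
  have hhor : P (T (e2 r 0)) ^ 2 ≤
      3456 * n * ∫ σ in (-1/2:ℝ)..1/2, P (T (e2 (r - σ ^ 2) σ)) ^ 2 := by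
    obtain ⟨q, hq, hqe⟩ := exists_polynomial_comp p hp (k := 2)
      (C (-a / 4) * X ^ 2 + C (b / 2) * X + C (a * r + u))
      (C (-c / 4) * X ^ 2 + C (d / 2) * X + C (c * r + v))
      (by compute_degree) (by compute_degree)
    have hq' : ∀ ξ, q.eval ξ = P (T (e2 (r - (1 / 2 * ξ) ^ 2) (1 / 2 * ξ))) := by
      intro ξ
      rw [hqe, hPT]
      simp only [eval_add, eval_mul, eval_C, eval_X, eval_pow, e2_apply_zero, e2_apply_one]
      congr 2
      ring_nf
    have := sq_eval_mul_sqrt_le (m := n * 2) (by omega) hq (t := 0)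
      ⟨by norm_num, by norm_num⟩
    simp only [hq'] at this
    have hi := intervalIntegral.integral_comp_mul_left
      (fun σ => P (T (e2 (r - σ ^ 2) σ)) ^ 2) (a := -1) (b := 1)
      (show (1 / 2 : ℝ) ≠ 0 by norm_num)
    norm_num at hi
    norm_num at this ⊢
    rw [hi] at this
    linarith
  have hcont : Continuous fun z : ℝ × ℝ => P (T (e2 (z.2 - z.1 ^ 2) z.1)) ^ 2 :=
    (hPc.comp (hTc.comp (continuous_e2.comp
      (by fun_prop : Continuous fun z : ℝ × ℝ => (z.2 - z.1 ^ 2, z.1))))).pow 2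
  have h_integral : (∫ σ in (-1/2:ℝ)..1/2, P (T (e2 (r - σ ^ 2) σ)) ^ 2) * √(1 - r) ≤
      1152 * n * ∫ σ in (-1/2:ℝ)..1/2, ∫ t in (-1/2:ℝ)..1, P (T (e2 (t - σ ^ 2) σ)) ^ 2 := by
    rw [← intervalIntegral.integral_mul_const, ← intervalIntegral.integral_const_mul]
    refine intervalIntegral.integral_mono_on (by norm_num) ?_ ?_ fun σ _ => hvert σ
    · apply Continuous.intervalIntegrable
      exact (hcont.comp (by fun_prop : Continuous fun σ : ℝ => (σ, r))).mul continuous_const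
    · apply Continuous.intervalIntegrable
      refine continuous_const.mul ?_
      exact intervalIntegral.continuous_parametric_intervalIntegral_of_continuous'
        (f := fun σ t => P (T (e2 (t - σ ^ 2) σ)) ^ 2) hcont _ _
  have hs0 := Real.sqrt_nonneg (1 - r)
  set J := ∫ σ in (-1/2:ℝ)..1/2, ∫ t in (-1/2:ℝ)..1, P (T (e2 (t - σ ^ 2) σ)) ^ 2
  have hJ : |adet T| * J ≤ ∫ z in D, P z ^ 2 :=
    (mul_le_mul_of_nonneg_left hsh (abs_nonneg _)).trans hD1
  have hDn : 0 ≤ ∫ z in D, P z ^ 2 := integral_nonneg fun _ => sq_nonneg _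
  have step : P (T (e2 r 0)) ^ 2 * √(1 - r) ≤ 3981312 * n ^ 2 * J := by
    have := mul_le_mul_of_nonneg_right hhor hs0
    have h2 := mul_le_mul_of_nonneg_left h_integral (show (0:ℝ) ≤ 3456 * n by positivity)
    linarith
  calc _ ≤ 3981312 * n ^ 2 * J * |adet T| := mul_le_mul_of_nonneg_right step (abs_nonneg _)
    _ = 3981312 * n ^ 2 * (|adet T| * J) := by ring
    _ ≤ 3981312 * n ^ 2 * ∫ z in D, P z ^ 2 := by gcongr
    _ ≤ _ := by gcongr; norm_num


lemma christoffel_set_nonempty (n : ℕ) (x : E2) (D : Set E2) :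
    { r : ℝ | ∃ p : MvPolynomial (Fin 2) ℝ, p.totalDegree ≤ n ∧
      MvPolynomial.eval (fun i => x i) p = 1 ∧
      r = ∫ y in D, (MvPolynomial.eval (fun i => y i) p) ^ 2 }.Nonempty :=
  ⟨_, 1, by simp, by simp, rfl⟩

/-- The quantity defining `L` bounds polynomials on a whole segment towards the origin. -/
lemma sq_eval_smul_le {D : Set E2} (hD : IsConvexBody D) (h0 : (0:E2) ∈ D)
    (T : E2 ≃ᵃ[ℝ] E2) {y : E2} (hy : y ∈ T '' ballE) (hT : T '' ballE ⊆ D) {n : ℕ} (hn : 1 ≤ n)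
    (p : MvPolynomial (Fin 2) ℝ) (hp : p.totalDegree ≤ n) {v : ℝ} (hv : v ∈ Icc (1/2:ℝ) 1) :
    MvPolynomial.eval (fun i => (v • y) i) p ^ 2 * (√(1 - ‖T.symm y‖) * |adet T|) ≤
      16000000 * n ^ 2 * ∫ z in D, MvPolynomial.eval (fun i => z i) p ^ 2 := by
  obtain ⟨w, hw, rfl⟩ := hy
  rw [AffineEquiv.symm_apply_apply]
  have hw1 : ‖w‖ ≤ 1 := by simpa [ballE] using hw
  obtain ⟨α, β, hαβ, hw0', hw1'⟩ : ∃ α β : ℝ, α ^ 2 + β ^ 2 = 1 ∧ w 0 = ‖w‖ * α ∧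
      w 1 = ‖w‖ * β := by
    by_cases hz : w = 0
    · exact ⟨1, 0, by norm_num, by simp [hz], by simp [hz]⟩
    · have := norm_pos_iff.mpr hz
      refine ⟨w 0 / ‖w‖, w 1 / ‖w‖, ?_, by field_simp, by field_simp⟩
      have := norm_sq_eq_coords w
      field_simp
      linarith
  obtain ⟨a, b, c, d, s, t, hT0, hT1, hdet⟩ := exists_coeffs T
  have hne := adet_ne_zero T
  have hv0 : 0 < v := lt_of_lt_of_le (by norm_num) hv.1
  have hdet' : (v * (a * α + b * β)) * (v * (-a * β + b * α)) * 0 +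
      ((v * (a * α + b * β)) * (v * (-c * β + d * α)) -
      (v * (-a * β + b * α)) * (v * (c * α + d * β))) = v ^ 2 * adet T := by
    rw [hdet]
    linear_combination (v ^ 2 * (a * d - b * c)) * hαβ
  rw [mul_zero, zero_add] at hdet'
  obtain ⟨T', h0', h1', hd'⟩ := exists_affineEquiv (v * (a * α + b * β)) (v * (-a * β + b * α))
    (v * (c * α + d * β)) (v * (-c * β + d * α)) (v * s) (v * t)
    (by rw [hdet']; positivity)
  have hT' : ∀ z, T' z = v • T (e2 (α * z 0 - β * z 1) (β * z 0 + α * z 1)) := by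
    intro z
    apply e2_ext
    · rw [h0', PiLp.smul_apply, hT0, smul_eq_mul, e2_apply_zero, e2_apply_one]
      ring
    · rw [h1', PiLp.smul_apply, hT1, smul_eq_mul, e2_apply_zero, e2_apply_one]
      ring
  have hsub : T' '' ballE ⊆ D := by
    rintro _ ⟨z, hz, rfl⟩
    rw [hT']
    refine hD.1.smul_mem_of_zero_mem h0 (hT ⟨_, ?_, rfl⟩) ⟨hv0.le, hv.2⟩
    simp only [ballE, mem_closedBall_zero_iff, norm_le_one_iff, e2_apply_zero,
      e2_apply_one] at hz ⊢
    linear_combination hz + (z 0 ^ 2 + z 1 ^ 2) * hαβ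
  have key := sq_eval_mul_sqrt_mul_adet_le T' hD.2.1 hsub (norm_nonneg w) hw1 hn p hp
  have he : T' (e2 ‖w‖ 0) = v • T w := by
    rw [hT']
    congr 2
    apply e2_ext
    · rw [hw0', e2_apply_zero, e2_apply_zero, e2_apply_one]
      ring
    · rw [hw1', e2_apply_zero, e2_apply_one, e2_apply_one]
      ring
  rw [he, hd', hdet', abs_mul, abs_of_pos (by positivity : 0 < v ^ 2)] at key
  have hv4 : 1 / 4 ≤ v ^ 2 := by nlinarith [hv.1]
  set A := MvPolynomial.eval (fun i => (v • T w) i) p ^ 2 * √(1 - ‖w‖) with hA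
  have hA0 : 0 ≤ A := by positivity
  have h3 : A * (1 / 4 * |adet T|) ≤ A * (v ^ 2 * |adet T|) := by gcongr
  rw [← mul_assoc, ← hA]
  linarith

set_option maxHeartbeats 1000000 in
lemma mul_le_christoffel {D : Set E2} (hD : IsConvexBody D) (h0 : (0:E2) ∈ D)
    {n : ℕ} (hn : 1 ≤ n) {x y : E2} {τ : ℝ} (hτ : τ ∈ Icc (1 - (16 * (n:ℝ) ^ 2)⁻¹) 1)
    (hxy : y = τ • x) (T : E2 ≃ᵃ[ℝ] E2) (hy : y ∈ T '' ballE) (hT : T '' ballE ⊆ D) :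
    (64000000:ℝ)⁻¹ * ((n:ℝ) ^ 2)⁻¹ * (√(1 - ‖T.symm y‖) * |adet T|) ≤ christoffel 2 n x D := by
  have hn' : (1:ℝ) ≤ n := by exact_mod_cast hn
  refine le_csInf (christoffel_set_nonempty n x D) ?_
  rintro _ ⟨p, hp, hpx, rfl⟩
  set I := ∫ z in D, MvPolynomial.eval (fun i => z i) p ^ 2
  have hI : 0 ≤ I := integral_nonneg fun _ => sq_nonneg _
  set r := √(1 - ‖T.symm y‖) * |adet T| with hr
  have hr0 : 0 ≤ r := by positivity
  rcases hr0.eq_or_lt with hr0 | hr0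
  · rw [← hr0, mul_zero]
    exact hI
  have hn2 : (1:ℝ) ≤ (n:ℝ) ^ 2 := by nlinarith
  have hτ1 : 1 - (16 * (n:ℝ) ^ 2)⁻¹ ≤ τ := hτ.1
  have hinv : (16 * (n:ℝ) ^ 2)⁻¹ = 1 / (n:ℝ) ^ 2 / 16 := by
    field_simp
  have hi1 : 1 / (n:ℝ) ^ 2 ≤ 1 := by rw [div_le_one (by positivity)]; exact hn2
  rw [hinv] at hτ1
  have hτ0 : 15 / 16 ≤ τ := by linarith
  obtain ⟨q, hq, hqe⟩ := exists_polynomial_comp p hp (k := 1)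
    (C (y 0 / 4) * X + C (3 / 4 * y 0)) (C (y 1 / 4) * X + C (3 / 4 * y 1))
    (by compute_degree) (by compute_degree)
  have hq' : ∀ ξ, q.eval ξ = MvPolynomial.eval (fun i => ((3 / 4 + ξ / 4) • y) i) p := by
    intro ξ
    rw [hqe]
    congr 2
    funext i
    fin_cases i
    · simp
      ring
    · simp
      ring
  have hb : ∀ ξ ∈ Icc (-1:ℝ) 1, |q.eval ξ| ≤ √(16000000 * n ^ 2 * I / r) := by
    intro ξ hξ
    refine Real.abs_le_sqrt ?_
    rw [le_div_iff₀ hr0, hq']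
    exact sq_eval_smul_le hD h0 T hy hT hn p hp ⟨by linarith [hξ.1], by linarith [hξ.2]⟩
  have hτ2 : 1 ≤ 1 / τ := by rw [le_div_iff₀ (by linarith)]; linarith [hτ.2]
  have hτ3 : 1 / τ ≤ 1 + 1 / (n:ℝ) ^ 2 / 8 := by
    rw [div_le_iff₀ (by linarith)]
    have : 0 ≤ 1 / (n:ℝ) ^ 2 := by positivity
    nlinarith
  have hgrow := abs_eval_le_two_mul hn (hq.trans (by simp)) hb (x := 4 / τ - 3)
    (by rw [show 4 / τ = 4 * (1 / τ) by ring]; linarith)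
    (by rw [show 4 / τ = 4 * (1 / τ) by ring,
          show 1 / (2 * (n:ℝ) ^ 2) = 1 / (n:ℝ) ^ 2 / 2 by field_simp]; linarith)
  have hx : (3 / 4 + (4 / τ - 3) / 4) • y = x := by
    rw [hxy, smul_smul]
    have : (3 / 4 + (4 / τ - 3) / 4) * τ = 1 := by
      have : τ ≠ 0 := by linarith
      field_simp
      ring
    rw [this, one_smul]
  rw [hq', hx, hpx, abs_one] at hgrow
  have hsq : 1 ≤ 4 * (16000000 * n ^ 2 * I / r) := by
    have := Real.sq_sqrt (show 0 ≤ 16000000 * (n:ℝ) ^ 2 * I / r by positivity)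
    nlinarith
  rw [← mul_div_assoc, le_div_iff₀ hr0] at hsq
  have : (64000000:ℝ)⁻¹ * ((n:ℝ) ^ 2)⁻¹ * r = r / (64000000 * (n:ℝ) ^ 2) := by
    field_simp
  rw [this, div_le_iff₀ (by positivity)]
  linarith

end LowerBound

section UpperBound

open Polynomial

/-- A univariate polynomial in an affine form of two variables. -/
lemma exists_mvPolynomial_comp (P : ℝ[X]) (a b c : ℝ) :
    ∃ p : MvPolynomial (Fin 2) ℝ, p.totalDegree ≤ P.natDegree ∧
      ∀ z : E2, MvPolynomial.eval (fun i => z i) p = P.eval (a * z 0 + b * z 1 + c) := by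
  set l : MvPolynomial (Fin 2) ℝ := MvPolynomial.C a * MvPolynomial.X 0 +
    MvPolynomial.C b * MvPolynomial.X 1 + MvPolynomial.C c with hl
  have hd : l.totalDegree ≤ 1 := by
    have h : ∀ (e : ℝ) (i : Fin 2),
        (MvPolynomial.C e * MvPolynomial.X i : MvPolynomial (Fin 2) ℝ).totalDegree ≤ 1 := by
      intro e i
      refine (MvPolynomial.totalDegree_mul _ _).trans ?_
      simp
    refine (MvPolynomial.totalDegree_add _ _).trans (max_le
      ((MvPolynomial.totalDegree_add _ _).trans (max_le (h _ _) (h _ _))) ?_)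
    simp
  refine ⟨aeval l P, ?_, fun z => ?_⟩
  · rw [aeval_eq_sum_range]
    refine MvPolynomial.totalDegree_finsetSum_le fun i hi => ?_
    refine (MvPolynomial.totalDegree_smul_le _ _).trans ?_
    refine (MvPolynomial.totalDegree_pow _ _).trans ?_
    have := Finset.mem_range.mp hi
    calc i * l.totalDegree ≤ i * 1 := by gcongr
      _ ≤ _ := by omega
  · rw [aeval_eq_sum_range, eval_eq_sum_range, map_sum]
    refine Finset.sum_congr rfl fun i _ => ?_
    simp [hl]

/-- A peaking polynomial in one affine coordinate which takes values in `[0, 1]` on `D`. -/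
lemma exists_peak_coordinate {D : Set E2} (hD : IsConvexBody D)
    (h1 : Metric.closedBall (0:E2) 1 ⊆ D) (h2 : D ⊆ Metric.closedBall (0:E2) 2)
    {n : ℕ} (hn : 1 ≤ n) {x y : E2} {τ : ℝ} (hx : x ∈ D)
    (hτ : τ ∈ Icc (1 - (16 * (n:ℝ) ^ 2)⁻¹) 1)
    (hxy : y = τ • x) (hy : y ∈ (1 - (16 * (n:ℝ) ^ 2)⁻¹) • D) {a b c : ℝ}
    (hab : a ≠ 0 ∨ b ≠ 0) (hpos : ∀ z ∈ D, 0 ≤ a * z 0 + b * z 1 + c)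
    (hle : ∀ z ∈ D, a * z 0 + b * z 1 + c ≤ 1) :
    ∃ (w : ℝ) (P : ℝ[X]), 0 < w ∧ (∀ z ∈ D, a * z 0 + b * z 1 + c ≤ w) ∧ P.natDegree ≤ n / 2 ∧
      P.eval (a * x 0 + b * x 1 + c) = 1 ∧
      ∫ s in (0:ℝ)..w, P.eval s ^ 2 ≤ 28672 / n * √(a * y 0 + b * y 1 + c) := by
  have hn' : (1:ℝ) ≤ n := by exact_mod_cast hn
  have hn2 : (1:ℝ) ≤ (n:ℝ) ^ 2 := by nlinarith
  set ℓ : E2 → ℝ := fun z => a * z 0 + b * z 1 + c with hℓ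
  have hℓc : Continuous ℓ := by fun_prop
  have hpos : ∀ z ∈ D, 0 ≤ ℓ z := hpos
  have h0D : (0:E2) ∈ D := h1 (by simp)
  obtain ⟨m, hmD, hm⟩ := hD.2.1.exists_isMaxOn ⟨0, h0D⟩ hℓc.continuousOn
  have hm : ∀ z ∈ D, ℓ z ≤ ℓ m := fun z hz => hm hz
  set w := ℓ m with hw
  have hw1 : w ≤ 1 := hle m hmD
  have hℓ0 : ℓ 0 = c := by simp [hℓ]
  have h0w : w / 3 ≤ c := by
    have hmem : -(1/2:ℝ) • m ∈ D := by
      apply h1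
      have := h2 hmD
      rw [mem_closedBall_zero_iff] at this ⊢
      rw [norm_smul]
      norm_num
      linarith
    have := hpos _ hmem
    simp only [hℓ, PiLp.smul_apply, smul_eq_mul] at this
    simp only [hw, hℓ]
    linarith
  have hw0 : 0 < w := by
    refine lt_of_le_of_ne (hpos m hmD) fun h => ?_
    have hc : c = 0 := le_antisymm (by rw [← hℓ0, h]; exact hm 0 h0D)
      (by rw [← hℓ0]; exact hpos 0 h0D)
    have e0 : e2 1 0 ∈ D := h1 (by
      rw [mem_closedBall_zero_iff, norm_le_one_iff, e2_apply_zero, e2_apply_one]; norm_num)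
    have e1 : e2 0 1 ∈ D := h1 (by
      rw [mem_closedBall_zero_iff, norm_le_one_iff, e2_apply_zero, e2_apply_one]; norm_num)
    have a1 := hm _ e0
    have a2 := hpos _ e0
    have b1 := hm _ e1
    have b2 := hpos _ e1
    rw [← h] at a1 b1
    simp only [hℓ, e2_apply_zero, e2_apply_one, hc] at a1 a2 b1 b2
    rcases hab with h | h
    · exact h (by linarith)
    · exact h (by linarith)
  set δ := (16 * (n:ℝ) ^ 2)⁻¹ with hδ
  have hδ0 : 0 < δ := by positivity
  have hδ1 : δ ≤ 1 / 16 := by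
    rw [hδ, inv_eq_one_div, div_le_div_iff₀ (by positivity) (by norm_num)]
    linarith
  have hyl : w / (48 * (n:ℝ) ^ 2) ≤ ℓ y := by
    obtain ⟨d, hd, rfl⟩ := hy
    have e : ℓ ((1 - δ) • d) = (1 - δ) * ℓ d + δ * c := by
      simp only [hℓ, PiLp.smul_apply, smul_eq_mul]
      ring
    have e' : w / (48 * (n:ℝ) ^ 2) = δ * (w / 3) := by
      rw [hδ]
      field_simp
      norm_num
    beta_reduce
    rw [e, e']
    have := mul_nonneg (show 0 ≤ 1 - δ by linarith) (hpos d hd)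
    nlinarith
  have hxl : ℓ x ≤ 16 / 15 * ℓ y := by
    have e : ℓ y = τ * ℓ x + (1 - τ) * c := by
      rw [hxy]
      simp only [hℓ, PiLp.smul_apply, smul_eq_mul]
      ring
    have hτ0 : 15 / 16 ≤ τ := by linarith [hτ.1]
    rw [e]
    have hc : 0 ≤ c := by linarith
    have := mul_nonneg (sub_nonneg.mpr hτ.2) hc
    have := mul_le_mul_of_nonneg_right hτ0 (hpos x hx)
    linarith
  have hyn : 0 ≤ ℓ y := le_trans (by positivity) hyl
  have hηsq : (7 * √(ℓ y / w)) ^ 2 = 49 * (ℓ y / w) := by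
    rw [mul_pow, Real.sq_sqrt (by positivity)]
    norm_num
  obtain ⟨P, hP1, hP2, hP3⟩ := exists_peak_polynomial hn (t := 1 - 2 / w * ℓ x)
    (η := 7 * √(ℓ y / w)) ⟨by
        have : ℓ x / w ≤ 1 := (div_le_one hw0).mpr (hm x hx)
        have e : 2 / w * ℓ x = 2 * (ℓ x / w) := by ring
        rw [e]
        linarith, by
        have : 0 ≤ 2 / w * ℓ x := mul_nonneg (by positivity) (hpos x hx)
        linarith⟩
    (by
      refine (sq_le_sq₀ (by positivity) (by positivity)).mp ?_
      rw [hηsq]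
      have e : (1 / (n:ℝ)) ^ 2 = 48 * (w / (48 * (n:ℝ) ^ 2) / w) := by
        field_simp
      have : w / (48 * (n:ℝ) ^ 2) / w ≤ ℓ y / w := by gcongr
      have : 0 ≤ ℓ y / w := by positivity
      linarith)
    (by
      rw [hηsq]
      have : ℓ x / w ≤ 16 / 15 * ℓ y / w := by gcongr
      have e : 2 / w * ℓ x = 2 * (ℓ x / w) := by ring
      have e' : 16 / 15 * ℓ y / w = 16 / 15 * (ℓ y / w) := by ring
      have : 0 ≤ ℓ y / w := by positivity
      linarith)
  have hcomp : ∀ s, (P.comp (C 1 - C (2 / w) * X)).eval s = P.eval (1 - 2 / w * s) := by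
    intro s
    simp
  refine ⟨w, P.comp (C 1 - C (2 / w) * X), hw0, hm, ?_, ?_, ?_⟩
  · refine natDegree_comp_le.trans ?_
    have : (C 1 - C (2 / w) * X : ℝ[X]).natDegree ≤ 1 := by compute_degree
    calc _ ≤ P.natDegree * 1 := by gcongr
      _ ≤ _ := by omega
  · rw [hcomp]
    exact hP2
  · simp_rw [hcomp]
    rw [intervalIntegral.integral_comp_sub_mul (fun s => P.eval s ^ 2) (by positivity)]
    rw [show 1 - 2 / w * w = -1 by field_simp; norm_num, mul_zero, sub_zero, smul_eq_mul]
    have e : √(ℓ y) = √w * √(ℓ y / w) := by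
      rw [← Real.sqrt_mul hw0.le]
      congr 1
      field_simp
    change _ ≤ 28672 / n * √(ℓ y)
    rw [e]
    have hwsq : w ≤ √w := by
      refine Real.le_sqrt_of_sq_le ?_
      nlinarith
    calc (2 / w)⁻¹ * ∫ s in (-1:ℝ)..1, P.eval s ^ 2 ≤ (2 / w)⁻¹ * (8192 * (7 * √(ℓ y / w)) / n) := by
          gcongr
      _ = 28672 / n * (w * √(ℓ y / w)) := by
          field_simp
          ring
      _ ≤ _ := by gcongr

lemma setIntegral_rectangle_mul {f g : ℝ → ℝ} (hf : Continuous f) (hg : Continuous g) {u v : ℝ}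
    (hu : 0 ≤ u) (hv : 0 ≤ v) :
    ∫ z in {z : E2 | z 0 ∈ Icc 0 u ∧ z 1 ∈ Icc 0 v}, f (z 0) * g (z 1) =
      (∫ s in (0:ℝ)..u, f s) * ∫ s in (0:ℝ)..v, g s := by
  have hm : MeasurableSet {z : E2 | z 0 ∈ Icc 0 u ∧ z 1 ∈ Icc 0 v} :=
    (measurableSet_Icc.preimage (by fun_prop)).inter (measurableSet_Icc.preimage (by fun_prop))
  conv_lhs => rw [← measurePreserving_e2.map_eq]
  rw [setIntegral_map hm (by
    apply Continuous.aestronglyMeasurable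
    fun_prop) continuous_e2.measurable.aemeasurable]
  change ∫ z in Icc 0 u ×ˢ Icc 0 v, f z.1 * g z.2 = _
  rw [Measure.volume_eq_prod, setIntegral_prod_mul, integral_Icc_eq_integral_Ioc,
    integral_Icc_eq_integral_Ioc, intervalIntegral.integral_of_le hu,
    intervalIntegral.integral_of_le hv]

lemma christoffel_le {D : Set E2} (hD : IsConvexBody D)
    (h1 : Metric.closedBall (0:E2) 1 ⊆ D) (h2 : D ⊆ Metric.closedBall (0:E2) 2)
    {n : ℕ} (hn : 1 ≤ n) {x y : E2} {τ : ℝ} (hx : x ∈ D)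
    (hτ : τ ∈ Icc (1 - (16 * (n:ℝ) ^ 2)⁻¹) 1)
    (hxy : y = τ • x) (hy : y ∈ (1 - (16 * (n:ℝ) ^ 2)⁻¹) • D)
    (T : E2 ≃ᵃ[ℝ] E2) (hT : D ⊆ T '' squareS) :
    christoffel 2 n x D ≤
      28672 ^ 2 * ((n:ℝ) ^ 2)⁻¹ * (√((T.symm y) 0 * (T.symm y) 1) * |adet T|) := by
  have hn' : (1:ℝ) ≤ n := by exact_mod_cast hn
  obtain ⟨a, b, c, d, p, q, hT0, hT1, hdet⟩ := exists_coeffs T.symm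
  have hdet0 : a * d - b * c ≠ 0 := hdet ▸ adet_ne_zero T.symm
  have hS : ∀ z ∈ D, T.symm z ∈ squareS := by
    intro z hz
    obtain ⟨w, hw, rfl⟩ := hT hz
    simpa using hw
  have hab : a ≠ 0 ∨ b ≠ 0 := by
    by_contra! h
    exact hdet0 (by rw [h.1, h.2]; ring)
  have hcd : c ≠ 0 ∨ d ≠ 0 := by
    by_contra! h
    exact hdet0 (by rw [h.1, h.2]; ring)
  obtain ⟨w₁, P, hw₁, hDw₁, hPd, hPx, hPi⟩ := exists_peak_coordinate hD h1 h2 hn hx hτ hxy hy hab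
    (fun z hz => by rw [← hT0]; exact (hS z hz).1.1)
    (fun z hz => by rw [← hT0]; exact (hS z hz).1.2)
  obtain ⟨w₂, Q, hw₂, hDw₂, hQd, hQx, hQi⟩ := exists_peak_coordinate hD h1 h2 hn hx hτ hxy hy hcd
    (fun z hz => by rw [← hT1]; exact (hS z hz).2.1)
    (fun z hz => by rw [← hT1]; exact (hS z hz).2.2)
  obtain ⟨p₁, hp₁, he₁⟩ := exists_mvPolynomial_comp P a b p
  obtain ⟨p₂, hp₂, he₂⟩ := exists_mvPolynomial_comp Q c d q
  have hmem : (∫ z in D, MvPolynomial.eval (fun i => z i) (p₁ * p₂) ^ 2) ∈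
      { r : ℝ | ∃ p : MvPolynomial (Fin 2) ℝ, p.totalDegree ≤ n ∧
        MvPolynomial.eval (fun i => x i) p = 1 ∧
        r = ∫ y in D, (MvPolynomial.eval (fun i => y i) p) ^ 2 } := by
    refine ⟨p₁ * p₂, (MvPolynomial.totalDegree_mul _ _).trans (by omega), ?_, rfl⟩
    rw [map_mul, he₁, he₂, hPx, hQx, one_mul]
  refine (csInf_le ⟨0, ?_⟩ hmem).trans ?_
  · rintro _ ⟨_, _, _, rfl⟩
    exact integral_nonneg fun _ => sq_nonneg _
  set R : Set E2 := {z : E2 | z 0 ∈ Icc 0 w₁ ∧ z 1 ∈ Icc 0 w₂} with hR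
  have hRm : MeasurableSet R :=
    (measurableSet_Icc.preimage (by fun_prop)).inter (measurableSet_Icc.preimage (by fun_prop))
  have hDR : D ⊆ T '' R := by
    intro z hz
    refine ⟨T.symm z, ⟨⟨(hS z hz).1.1, ?_⟩, (hS z hz).2.1, ?_⟩, by simp⟩
    · rw [hT0]
      exact hDw₁ z hz
    · rw [hT1]
      exact hDw₂ z hz
  have hRc : IsCompact (T '' R) := by
    refine IsCompact.image ?_ T.toContinuousAffineEquiv.continuous
    have : R = (fun z : ℝ × ℝ => e2 z.1 z.2) '' (Icc 0 w₁ ×ˢ Icc 0 w₂) := by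
      ext z
      constructor
      · rintro ⟨h, h'⟩
        exact ⟨(z 0, z 1), ⟨h, h'⟩, e2_ext rfl rfl⟩
      · rintro ⟨⟨s, t⟩, ⟨h, h'⟩, rfl⟩
        exact ⟨h, h'⟩
    rw [this]
    exact (isCompact_Icc.prod isCompact_Icc).image continuous_e2
  have hc : Continuous fun z : E2 => MvPolynomial.eval (fun i => z i) (p₁ * p₂) ^ 2 :=
    (continuous_eval_coords _).pow 2
  calc ∫ z in D, MvPolynomial.eval (fun i => z i) (p₁ * p₂) ^ 2
      ≤ ∫ z in T '' R, MvPolynomial.eval (fun i => z i) (p₁ * p₂) ^ 2 :=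
        setIntegral_mono_set (hc.continuousOn.integrableOn_compact hRc)
          (Filter.Eventually.of_forall fun z => sq_nonneg _) hDR.eventuallyLE
    _ = |adet T| * ∫ z in R, P.eval (z 0) ^ 2 * Q.eval (z 1) ^ 2 := by
        rw [setIntegral_affineEquiv_image T hRm
          (fun z => MvPolynomial.eval (fun i => z i) (p₁ * p₂) ^ 2)]
        congr 2
        funext z
        rw [map_mul, he₁, he₂, mul_pow, ← hT0, ← hT1, AffineEquiv.symm_apply_apply]
    _ = |adet T| * ((∫ s in (0:ℝ)..w₁, P.eval s ^ 2) * ∫ s in (0:ℝ)..w₂, Q.eval s ^ 2) := by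
        rw [setIntegral_rectangle_mul (f := fun s => P.eval s ^ 2) (g := fun s => Q.eval s ^ 2)
          (by fun_prop) (by fun_prop) hw₁.le hw₂.le]
    _ ≤ |adet T| * ((28672 / n * √((T.symm y) 0)) * (28672 / n * √((T.symm y) 1))) := by
        rw [hT0, hT1]
        gcongr
        exact intervalIntegral.integral_nonneg hw₂.le fun _ _ => sq_nonneg _
    _ = _ := by
        have hy0 : 0 ≤ (T.symm y) 0 := by
          have h0D : (0:E2) ∈ D := h1 (by simp)
          refine (hS y ?_).1.1
          rw [hxy]
          refine hD.1.smul_mem_of_zero_mem h0D hx ⟨?_, hτ.2⟩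
          refine le_trans ?_ hτ.1
          rw [sub_nonneg]
          refine inv_le_one_of_one_le₀ ?_
          nlinarith
        rw [Real.sqrt_mul hy0]
        field_simp

end UpperBound

section Geometry

lemma mem_half_square {u : E2} (h0 : u 0 ∈ Icc (0:ℝ) (1/2)) (h1 : u 1 ∈ Icc (0:ℝ) (1/2)) :
    u ∈ (2:ℝ)⁻¹ • squareS := by
  rw [mem_smul_set_iff_inv_smul_mem₀ (by norm_num), inv_inv]
  refine ⟨⟨?_, ?_⟩, ?_, ?_⟩ <;> simp only [PiLp.smul_apply, smul_eq_mul]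
  · linarith [h0.1]
  · linarith [h0.2]
  · linarith [h1.1]
  · linarith [h1.2]

/-- A parallelogram around `D` given by two affine forms. -/
lemma exists_parallelogram {D : Set E2} {y : E2} (hy : y ∈ D) {a b c d p q : ℝ}
    (hdet : a * d - b * c ≠ 0)
    (h0 : ∀ z ∈ D, a * z 0 + b * z 1 + p ∈ Icc (0:ℝ) (1/2))
    (h1 : ∀ z ∈ D, c * z 0 + d * z 1 + q ∈ Icc (0:ℝ) (1/2)) :
    ∃ T : E2 ≃ᵃ[ℝ] E2, y ∈ T '' ((2:ℝ)⁻¹ • squareS) ∧ D ⊆ T '' squareS ∧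
      √((T.symm y) 0 * (T.symm y) 1) * |adet T| =
      √((a * y 0 + b * y 1 + p) * (c * y 0 + d * y 1 + q)) / |a * d - b * c| := by
  obtain ⟨S, hS0, hS1, hSd⟩ := exists_affineEquiv a b c d p q hdet
  refine ⟨S.symm, ⟨S y, mem_half_square ?_ ?_, by simp⟩, fun z hz => ⟨S z, ⟨?_, ?_⟩, by simp⟩, ?_⟩
  · rw [hS0]; exact h0 y hy
  · rw [hS1]; exact h1 y hy
  · rw [hS0]; exact Icc_subset_Icc_right (by norm_num) (h0 z hz)
  · rw [hS1]; exact Icc_subset_Icc_right (by norm_num) (h1 z hz)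
  · change √((S y) 0 * (S y) 1) * _ = _
    rw [hS0, hS1, adet_symm, hSd, abs_inv, div_eq_mul_inv]

lemma continuousLinear_apply_coords (f : E2 →L[ℝ] ℝ) (z : E2) :
    f z = f (e2 1 0) * z 0 + f (e2 0 1) * z 1 := by
  have h : z = z 0 • e2 1 0 + z 1 • e2 0 1 := by
    apply e2_ext <;> simp [e2_apply_zero, e2_apply_one]
  conv_lhs => rw [h]
  rw [map_add, map_smul, map_smul, smul_eq_mul, smul_eq_mul]
  ring

/-- A large ellipse inside the part of a parabola below a horizontal line. -/
lemma exists_ellipse_subset {D : Set E2} {d : ℝ} (hd : d ∈ Icc (0:ℝ) 1) {κ : ℝ} (hκ : 50 ≤ κ)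
    (h : ∀ z : E2, |z 0| ≤ 1 / 10 → z 1 ≤ 11 / 10 → κ * z 0 ^ 2 ≤ z 1 - d / 2 → z ∈ D) :
    ∃ T : E2 ≃ᵃ[ℝ] E2, e2 0 d ∈ T '' ballE ∧ T '' ballE ⊆ D ∧
      3 / 100 * √(d / κ) ≤ √(1 - ‖T.symm (e2 0 d)‖) * |adet T| := by
  obtain ⟨hd0, hd1⟩ := hd
  set β := (11 / 10 - d / 2) / 2 with hβ
  have hβ1 : 3 / 10 ≤ β := by linarith
  have hβ2 : β ≤ 55 / 100 := by linarith
  set A := √(β / (2 * κ)) with hA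
  have hAsq : A ^ 2 = β / (2 * κ) := Real.sq_sqrt (by positivity)
  have hκA : κ * A ^ 2 = β / 2 := by
    rw [hAsq]
    field_simp
  have hA0 : 0 < A := Real.sqrt_pos.mpr (by positivity)
  have hA1 : A ≤ 1 / 10 := by nlinarith
  obtain ⟨T, hT0, hT1, hTd⟩ := exists_affineEquiv A 0 0 β 0 (d / 2 + β) (by
    have := mul_pos hA0 (show 0 < β by linarith)
    linarith)
  have hu : T (e2 0 ((d / 2 - β) / β)) = e2 0 d := by
    apply e2_ext
    · rw [hT0, e2_apply_zero, e2_apply_zero]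
      ring
    · rw [hT1, e2_apply_one, e2_apply_one]
      field_simp
      ring
  have hsymm : T.symm (e2 0 d) = e2 0 ((d / 2 - β) / β) := by
    rw [← hu, AffineEquiv.symm_apply_apply]
  have hnorm : ‖e2 0 ((d / 2 - β) / β)‖ ≤ 1 - d / 10 := by
    refine le_of_sq_le_sq ?_ (by linarith)
    rw [norm_sq_eq_coords, e2_apply_zero, e2_apply_one, zero_pow two_ne_zero, zero_add]
    refine sq_le_sq' ?_ ?_
    · rw [le_div_iff₀ (by linarith)]
      nlinarith
    · rw [div_le_iff₀ (by linarith)]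
      nlinarith
  refine ⟨T, ⟨_, ?_, hu⟩, ?_, ?_⟩
  · rw [ballE, mem_closedBall_zero_iff]
    linarith
  · rintro _ ⟨v, hv, rfl⟩
    rw [ballE, mem_closedBall_zero_iff, norm_le_one_iff] at hv
    have hv0 : |v 0| ≤ 1 := abs_le_one_iff_mul_self_le_one.mpr (by nlinarith [sq_nonneg (v 1)])
    have hv1 : |v 1| ≤ 1 := abs_le_one_iff_mul_self_le_one.mpr (by nlinarith [sq_nonneg (v 0)])
    obtain ⟨hv1, hv1'⟩ := abs_le.mp hv1
    apply h
    · rw [hT0, zero_mul, add_zero, add_zero, abs_mul, abs_of_pos hA0]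
      nlinarith [abs_nonneg (v 0)]
    · rw [hT1]
      nlinarith
    · rw [hT0, hT1]
      have e : κ * (A * v 0 + 0 * v 1 + 0) ^ 2 = β / 2 * v 0 ^ 2 := by
        rw [← hκA]
        ring
      rw [e]
      have h1 : v 0 ^ 2 ≤ 2 * (1 + v 1) := by nlinarith
      have h2 := mul_le_mul_of_nonneg_left h1 (show 0 ≤ β / 2 by linarith)
      linarith
  · rw [hsymm, hTd, mul_zero, sub_zero, abs_of_pos (by positivity)]
    have h1 : √(d / 10) ≤ √(1 - ‖e2 0 ((d / 2 - β) / β)‖) := Real.sqrt_le_sqrt (by linarith)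
    have h2 : √(3 / 20 / κ) ≤ A := Real.sqrt_le_sqrt (by
      rw [div_le_div_iff₀ (by positivity) (by positivity)]
      nlinarith)
    have h3 : 1 / 10 * √(d / κ) ≤ √(d / 10) * √(3 / 20 / κ) := by
      rw [← Real.sqrt_mul (by positivity)]
      refine Real.le_sqrt_of_sq_le ?_
      rw [mul_pow, Real.sq_sqrt (by positivity)]
      have e : d / 10 * (3 / 20 / κ) = 3 / 200 * (d / κ) := by ring
      rw [e]
      have : 0 ≤ d / κ := by positivity
      linarith
    calc 3 / 100 * √(d / κ) = 1 / 10 * √(d / κ) * (3 / 10) := by ring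
      _ ≤ (√(d / 10) * √(3 / 20 / κ)) * (3 / 10) := by gcongr
      _ ≤ (√(1 - ‖e2 0 ((d / 2 - β) / β)‖) * A) * β := by gcongr
      _ = _ := by ring

/-- A planar body in normalised position: it lies in the half-plane `{z 1 ≥ 0}`, touches its
boundary at the origin and is balanced around `(0, 1)`. -/
structure IsNormalised (D : Set E2) : Prop where
  convex : Convex ℝ D
  isClosed : IsClosed D
  zero_mem : e2 0 0 ∈ D
  nonneg : ∀ z ∈ D, 0 ≤ z 1
  abs_coord_le : ∀ z ∈ D, |z 0| ≤ 2
  square : ∀ s t : ℝ, |s| ≤ 1/5 → |t - 1| ≤ 1/5 → e2 s t ∈ D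
  reflect : ∀ z ∈ D, e2 (-(z 0) / 2) (3 / 2 - z 1 / 2) ∈ D

namespace IsNormalised

variable {D : Set E2}

lemma axis_mem (hD : IsNormalised D) {d : ℝ} (hd : d ∈ Icc (0:ℝ) 1) : e2 0 d ∈ D := by
  have h1 := hD.square 0 1 (by norm_num) (by norm_num)
  have := hD.convex hD.zero_mem h1 (sub_nonneg.mpr hd.2) hd.1 (by ring)
  convert this using 1
  apply e2_ext <;> simp [e2_apply_zero, e2_apply_one]

lemma affine_le (hD : IsNormalised D) {a b c : ℝ} (h : ∀ z ∈ D, 0 ≤ a * z 0 + b * z 1 + c)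
    {z : E2} (hz : z ∈ D) : a * z 0 + b * z 1 + c ≤ 3 * (b + c) := by
  have := h _ (hD.reflect z hz)
  rw [e2_apply_zero, e2_apply_one] at this
  linarith

lemma le_of_forall_parallelogram (hD : IsNormalised D) {d : ℝ} (hd : d ∈ Icc (0:ℝ) 1) {V : ℝ}
    (hV : ∀ T : E2 ≃ᵃ[ℝ] E2, e2 0 d ∈ T '' ((2:ℝ)⁻¹ • squareS) → D ⊆ T '' squareS →
      V ≤ √((T.symm (e2 0 d)) 0 * (T.symm (e2 0 d)) 1) * |adet T|) :
    V ≤ 10 * √d := by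
  obtain ⟨T, hT1, hT2, hT3⟩ := exists_parallelogram (hD.axis_mem hd) (a := 0) (b := 1 / 6)
    (c := 1 / 8) (d := 0) (p := 0) (q := 1 / 4) (by norm_num)
    (fun z hz => by
      have h1 := hD.nonneg z hz
      have h2 := hD.affine_le (a := 0) (b := 1) (c := 0) (fun z hz => by
        have := hD.nonneg z hz
        linarith) hz
      constructor <;> linarith)
    (fun z hz => by
      have h1 := abs_le.mp (hD.abs_coord_le z hz)
      constructor <;> linarith [h1.1, h1.2])
  have := hV T hT1 hT2
  rw [hT3, e2_apply_zero, e2_apply_one] at this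
  refine this.trans ?_
  rw [div_le_iff₀ (by norm_num)]
  refine (Real.sqrt_le_left (by positivity)).mpr ?_
  rw [mul_pow, mul_pow, Real.sq_sqrt hd.1]
  norm_num
  linarith [hd.1]

lemma le_of_not_mem (hD : IsNormalised D) {d : ℝ} (hd : d ∈ Icc (0:ℝ) 1) {V κ : ℝ} (hκ : 0 < κ)
    (hV : ∀ T : E2 ≃ᵃ[ℝ] E2, e2 0 d ∈ T '' ((2:ℝ)⁻¹ • squareS) → D ⊆ T '' squareS →
      V ≤ √((T.symm (e2 0 d)) 0 * (T.symm (e2 0 d)) 1) * |adet T|)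
    {z : E2} (hz : z ∉ D) (hz0 : |z 0| ≤ 1 / 10) (hz1 : z 1 ≤ 11 / 10)
    (hz2 : κ * z 0 ^ 2 ≤ z 1 - d / 2) :
    V ≤ 6 * √(d / κ) := by
  obtain ⟨f, u, hf, hfz⟩ := geometric_hahn_banach_closed_point hD.convex hD.isClosed hz
  set α := f (e2 1 0)
  set β := f (e2 0 1)
  have hfc : ∀ w, f w = α * w 0 + β * w 1 := continuousLinear_apply_coords f
  have hβ : β < 0 := by
    have h := hf _ (hD.square (z 0) (11 / 10) (by linarith) (by norm_num))
    rw [hfc, e2_apply_zero, e2_apply_one] at h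
    rw [hfc] at hfz
    by_contra! hβ
    nlinarith
  set σ := -(α / β) with hσ
  set e := -(u / β) with he
  have hℓ : ∀ w : E2, w 1 - σ * w 0 + e = (f w - u) / β := by
    intro w
    rw [hfc, hσ, he]
    field_simp [hβ.ne]
    ring
  have hpos : ∀ w ∈ D, 0 ≤ w 1 - σ * w 0 + e := by
    intro w hw
    rw [hℓ]
    exact div_nonneg_of_nonpos (by linarith [hf w hw]) hβ.le
  have hneg : z 1 - σ * z 0 + e < 0 := by
    rw [hℓ]
    exact div_neg_of_pos_of_neg (by linarith) hβ
  have he0 : 0 ≤ e := by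
    have := hpos _ hD.zero_mem
    rw [e2_apply_zero, e2_apply_one] at this
    linarith
  have hσ1 : |σ| ≤ 5 * (1 + e) := by
    have h1 := hpos _ (hD.square (1 / 5) 1 (by norm_num [abs_of_pos]) (by norm_num))
    have h2 := hpos _ (hD.square (-(1 / 5)) 1 (by norm_num [abs_of_pos]) (by norm_num))
    rw [e2_apply_zero, e2_apply_one] at h1 h2
    rw [abs_le]
    constructor <;> linarith
  have hκz : 0 ≤ κ * z 0 ^ 2 := by positivity
  have he1 : e < 1 := by
    have h1 : σ * z 0 ≤ |σ| * (1 / 10) := by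
      refine (le_abs_self _).trans ?_
      rw [abs_mul]
      gcongr
    linarith [hd.1]
  have hdisc : 2 * κ * (d + e) ≤ σ ^ 2 := by
    have := mul_pos hκ (show 0 < σ * z 0 - κ * z 0 ^ 2 - d / 2 - e by linarith)
    nlinarith [sq_nonneg (2 * κ * z 0 - σ), mul_nonneg hκ.le he0]
  have hσ0 : σ ≠ 0 := by
    intro h
    rw [h] at hneg
    linarith [hd.1]
  have hpos' : 0 < 6 * (1 + e) := by linarith
  have hdet : (0:ℝ) * (1 / (6 * (1 + e))) - 1 / 6 * (-σ / (6 * (1 + e))) = σ / (36 * (1 + e)) := by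
    field_simp
    ring
  obtain ⟨T, hT1, hT2, hT3⟩ := exists_parallelogram (hD.axis_mem hd) (a := 0) (b := 1 / 6)
    (c := -σ / (6 * (1 + e))) (d := 1 / (6 * (1 + e))) (p := 0) (q := e / (6 * (1 + e)))
    (by rw [hdet]; positivity)
    (fun z hz => by
      have h1 := hD.nonneg z hz
      have h2 := hD.affine_le (a := 0) (b := 1) (c := 0) (fun z hz => by
        have := hD.nonneg z hz
        linarith) hz
      constructor <;> linarith)
    (fun z hz => by
      have h1 := hpos z hz
      have h2 := hD.affine_le (a := -σ) (b := 1) (c := e) (fun z hz => by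
        have := hpos z hz
        linarith) hz
      have e' : -σ / (6 * (1 + e)) * z 0 + 1 / (6 * (1 + e)) * z 1 + e / (6 * (1 + e)) =
          (z 1 - σ * z 0 + e) / (6 * (1 + e)) := by ring
      rw [e']
      refine ⟨by positivity, ?_⟩
      rw [div_le_iff₀ hpos']
      linarith)
  have := hV T hT1 hT2
  rw [hT3, hdet, e2_apply_zero, e2_apply_one] at this
  refine this.trans ?_
  have h36 : 0 < |σ / (36 * (1 + e))| := abs_pos.mpr (by positivity)
  rw [div_le_iff₀ h36]
  refine (Real.sqrt_le_left (by positivity)).mpr ?_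
  rw [mul_pow, mul_pow, Real.sq_sqrt (div_nonneg hd.1 hκ.le), sq_abs]
  have e1 : (0 * 0 + 1 / 6 * d + 0) *
      (-σ / (6 * (1 + e)) * 0 + 1 / (6 * (1 + e)) * d + e / (6 * (1 + e))) =
      d * (2 * κ * (d + e)) * (2 * (1 + e)) / (144 * κ * (1 + e) ^ 2) := by
    field_simp
    ring
  have e3 : 6 ^ 2 * (d / κ) * (σ / (36 * (1 + e))) ^ 2 =
      d * σ ^ 2 * 4 / (144 * κ * (1 + e) ^ 2) := by
    field_simp
    ring
  rw [e1, e3]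
  have := hd.1
  gcongr
  linarith

lemma exists_ball_image (hD : IsNormalised D) {d : ℝ} (hd : d ∈ Icc (0:ℝ) 1) {V : ℝ} (hV0 : 0 < V)
    (hV : ∀ T : E2 ≃ᵃ[ℝ] E2, e2 0 d ∈ T '' ((2:ℝ)⁻¹ • squareS) → D ⊆ T '' squareS →
      V ≤ √((T.symm (e2 0 d)) 0 * (T.symm (e2 0 d)) 1) * |adet T|) :
    ∃ T : E2 ≃ᵃ[ℝ] E2, e2 0 d ∈ T '' ballE ∧ T '' ballE ⊆ D ∧
      V ≤ 2500 * (√(1 - ‖T.symm (e2 0 d)‖) * |adet T|) := by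
  have hVd := hD.le_of_forall_parallelogram hd hV
  have hd0 : 0 < d := by
    refine lt_of_le_of_ne hd.1 fun h => ?_
    rw [← h, Real.sqrt_zero] at hVd
    linarith
  set κ := max 50 (144 * d / V ^ 2) with hκ
  have hκ50 : 50 ≤ κ := le_max_left _ _
  have hdκ : 6 * √(d / κ) ≤ V / 2 := by
    have h1 : d / κ ≤ V ^ 2 / 144 := by
      rw [div_le_iff₀ (by linarith)]
      have := mul_le_mul_of_nonneg_left (le_max_right 50 (144 * d / V ^ 2))
        (show 0 ≤ V ^ 2 / 144 by positivity)
      have e : V ^ 2 / 144 * (144 * d / V ^ 2) = d := by field_simp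
      linarith
    have h2 : √(d / κ) ≤ V / 12 := by
      refine (Real.sqrt_le_left (by linarith)).mpr ?_
      linarith
    linarith
  have hVκ : V ≤ 75 * √(d / κ) := by
    rcases max_choice 50 (144 * d / V ^ 2) with h | h
    · have e : √d = √50 * √(d / κ) := by
        rw [hκ, h, ← Real.sqrt_mul (by norm_num)]
        congr 1
        ring
      have h50 : √50 ≤ 7.5 := (Real.sqrt_le_left (by norm_num)).mpr (by norm_num)
      rw [e] at hVd
      have := mul_le_mul_of_nonneg_right h50 (Real.sqrt_nonneg (d / κ))
      linarith
    · have e : d / κ = (V / 12) ^ 2 := by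
        rw [hκ, h]
        field_simp
        norm_num
      rw [e, Real.sqrt_sq (by linarith)]
      linarith
  obtain ⟨T, h1, h2, h3⟩ := exists_ellipse_subset hd hκ50 fun z hz0 hz1 hz2 => by
    by_contra hz
    have := hD.le_of_not_mem hd (by linarith) hV hz hz0 hz1 hz2
    linarith
  exact ⟨T, h1, h2, by linarith⟩

end IsNormalised

end Geometry

section Comparison

lemma adet_trans (T S : E2 ≃ᵃ[ℝ] E2) : adet (T.trans S) = adet S * adet T := by
  rw [adet, adet, adet, ← LinearMap.det_comp]
  rfl

/-- A supporting affine form at the exit point of a ray from the origin. -/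
lemma exists_support {D : Set E2} (hD : IsConvexBody D) (h1 : Metric.closedBall (0:E2) 1 ⊆ D)
    (h2 : D ⊆ Metric.closedBall (0:E2) 2) {a b : ℝ} (hab : a ^ 2 + b ^ 2 = 1) :
    ∃ ρ α β : ℝ, 1 ≤ ρ ∧ ρ ≤ 2 ∧ e2 (ρ * a) (ρ * b) ∈ D ∧
      (∀ r, 0 ≤ r → e2 (r * a) (r * b) ∈ D → r ≤ ρ) ∧ ρ * (α * a + β * b) = 1 ∧
      ∀ z ∈ D, α * z 0 + β * z 1 ≤ 1 := by
  have hnorm : ∀ r, 0 ≤ r → ‖e2 (r * a) (r * b)‖ = r := by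
    intro r hr
    rw [← sq_eq_sq₀ (norm_nonneg _) hr, norm_sq_eq_coords, e2_apply_zero, e2_apply_one]
    linear_combination r ^ 2 * hab
  have hc : Continuous fun r : ℝ => e2 (r * a) (r * b) :=
    continuous_e2.comp (by fun_prop : Continuous fun r : ℝ => (r * a, r * b))
  have hle : ∀ r, 0 ≤ r → e2 (r * a) (r * b) ∈ D → r ≤ 2 := by
    intro r hr hrD
    have := h2 hrD
    rwa [mem_closedBall_zero_iff, hnorm r hr] at this
  set K : Set ℝ := Icc 0 2 ∩ (fun r : ℝ => e2 (r * a) (r * b)) ⁻¹' D with hK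
  have hKc : IsCompact K := isCompact_Icc.inter_right (hD.2.1.isClosed.preimage hc)
  have h1K : (1:ℝ) ∈ K := ⟨by norm_num, h1 (by
    rw [mem_closedBall_zero_iff, hnorm 1 zero_le_one])⟩
  obtain ⟨ρ, ⟨hρ, hρD⟩, hmax⟩ := hKc.exists_isGreatest ⟨1, h1K⟩
  have hρ1 : 1 ≤ ρ := hmax h1K
  have hmax' : ∀ r, 0 ≤ r → e2 (r * a) (r * b) ∈ D → r ≤ ρ :=
    fun r hr hrD => hmax ⟨⟨hr, hle r hr hrD⟩, hrD⟩
  have hnot : e2 (ρ * a) (ρ * b) ∉ interior D := by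
    intro h_integral
    have hnhds : ∀ᶠ r in nhds ρ, e2 (r * a) (r * b) ∈ interior D :=
      hc.continuousAt.eventually (isOpen_interior.mem_nhds h_integral)
    obtain ⟨ε, hε, hball⟩ := Metric.eventually_nhds_iff.mp hnhds
    have := hmax' (ρ + ε / 2) (by linarith) (interior_subset (hball (by
      rw [Real.dist_eq, add_sub_cancel_left, abs_of_pos (by positivity)]
      linarith)))
    linarith
  obtain ⟨f, hf⟩ := geometric_hahn_banach_open_point hD.1.interior isOpen_interior hnot
  set F := f (e2 (ρ * a) (ρ * b)) with hF
  have hF0 : 0 < F := by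
    have h0 : (0:E2) ∈ interior D := by
      rw [mem_interior_iff_mem_nhds]
      exact Filter.mem_of_superset (Metric.closedBall_mem_nhds 0 one_pos) h1
    simpa using hf 0 h0
  have hfD : ∀ z ∈ D, f z ≤ F := by
    intro z hz
    have hcl : closure (interior D) ⊆ {w | f w ≤ F} :=
      closure_minimal (fun w hw => (hf w hw).le) (isClosed_le f.continuous continuous_const)
    refine hcl ?_
    rw [hD.1.closure_interior_eq_closure_of_nonempty_interior hD.2.2]
    exact subset_closure hz
  refine ⟨ρ, f (e2 1 0) / F, f (e2 0 1) / F, hρ1, hρ.2, hρD, hmax', ?_, fun z hz => ?_⟩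
  · have := continuousLinear_apply_coords f (e2 (ρ * a) (ρ * b))
    rw [e2_apply_zero, e2_apply_one, ← hF] at this
    field_simp
    linarith
  · have := hfD z hz
    rw [continuousLinear_apply_coords] at this
    have e : f (e2 1 0) / F * z 0 + f (e2 0 1) / F * z 1 =
        (f (e2 1 0) * z 0 + f (e2 0 1) * z 1) / F := by ring
    rw [e, div_le_one hF0]
    exact this

/-- A convex body between `B` and `2B` can be put in normalised position with any prescribed
point on the vertical axis. -/
lemma exists_isNormalised {D : Set E2} (hD : IsConvexBody D)
    (h1 : Metric.closedBall (0:E2) 1 ⊆ D) (h2 : D ⊆ Metric.closedBall (0:E2) 2)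
    {y : E2} (hy : y ∈ D) :
    ∃ (Φ : E2 ≃ᵃ[ℝ] E2) (d : ℝ), IsNormalised (Φ ⁻¹' D) ∧ d ∈ Icc (0:ℝ) 1 ∧ Φ (e2 0 d) = y := by
  obtain ⟨a, b, hab, hy0, hy1⟩ : ∃ a b : ℝ, a ^ 2 + b ^ 2 = 1 ∧ y 0 = ‖y‖ * a ∧
      y 1 = ‖y‖ * b := by
    by_cases hz : y = 0
    · exact ⟨1, 0, by norm_num, by simp [hz], by simp [hz]⟩
    · have := norm_pos_iff.mpr hz
      refine ⟨y 0 / ‖y‖, y 1 / ‖y‖, ?_, by field_simp, by field_simp⟩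
      have := norm_sq_eq_coords y
      field_simp
      linarith
  obtain ⟨ρ, α, β, hρ1, hρ2, hρD, hmax, hφ, hφD⟩ := exists_support hD h1 h2 hab
  have hyρ : ‖y‖ ≤ ρ := by
    refine hmax _ (norm_nonneg y) ?_
    convert hy using 1
    exact e2_ext hy0.symm hy1.symm
  obtain ⟨c, hc⟩ : ∃ c, c = -ρ * (-α * b + β * a) := ⟨_, rfl⟩
  have hcabs : |c| ≤ 2 := by
    have p1 := hφD _ (h1 (show e2 (-b) a ∈ Metric.closedBall (0:E2) 1 by
      rw [mem_closedBall_zero_iff, norm_le_one_iff, e2_apply_zero, e2_apply_one]; linarith))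
    have p2 := hφD _ (h1 (show e2 b (-a) ∈ Metric.closedBall (0:E2) 1 by
      rw [mem_closedBall_zero_iff, norm_le_one_iff, e2_apply_zero, e2_apply_one]; linarith))
    rw [e2_apply_zero, e2_apply_one] at p1 p2
    rw [hc, abs_mul, abs_neg, abs_of_pos (by linarith)]
    have : |-α * b + β * a| ≤ 1 := abs_le.mpr ⟨by linarith, by linarith⟩
    nlinarith [abs_nonneg (-α * b + β * a)]
  have hdet : (-b + c * a) * (-ρ * b) - (-ρ * a) * (a + c * b) = ρ := by
    linear_combination ρ * hab
  obtain ⟨Φ, hΦ0, hΦ1, -⟩ := exists_affineEquiv (-b + c * a) (-ρ * a) (a + c * b) (-ρ * b)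
    (ρ * a) (ρ * b) (by rw [hdet]; linarith)
  have hφΦ : ∀ z, α * (Φ z) 0 + β * (Φ z) 1 = 1 - z 1 := by
    intro z
    rw [hΦ0, hΦ1, hc]
    linear_combination (1 - z 1 - z 0 * (-α * b + β * a)) * hφ
  refine ⟨Φ, 1 - ‖y‖ / ρ, ⟨?_, ?_, ?_, ?_, ?_, ?_, ?_⟩, ⟨?_, ?_⟩, ?_⟩
  · exact hD.1.affine_preimage (Φ : E2 →ᵃ[ℝ] E2)
  · exact hD.2.1.isClosed.preimage Φ.toContinuousAffineEquiv.continuous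
  · have : Φ (e2 0 0) = e2 (ρ * a) (ρ * b) := by
      apply e2_ext
      · rw [hΦ0, e2_apply_zero, e2_apply_zero, e2_apply_one]
        ring
      · rw [hΦ1, e2_apply_zero, e2_apply_one, e2_apply_one]
        ring
    rw [mem_preimage, this]
    exact hρD
  · intro z hz
    have := hφD _ hz
    rw [hφΦ] at this
    linarith
  · intro z hz
    have hn := h2 hz
    rw [mem_closedBall_zero_iff] at hn
    have hn2 : (Φ z) 0 ^ 2 + (Φ z) 1 ^ 2 ≤ 2 ^ 2 := by
      rw [← norm_sq_eq_coords]
      gcongr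
    have e : z 0 = -b * (Φ z) 0 + a * (Φ z) 1 := by
      rw [hΦ0, hΦ1]
      linear_combination (-z 0) * hab
    refine abs_le_of_sq_le_sq (le_trans ?_ hn2) (by norm_num)
    have e' : z 0 ^ 2 + (a * (Φ z) 0 + b * (Φ z) 1) ^ 2 = (Φ z) 0 ^ 2 + (Φ z) 1 ^ 2 := by
      rw [e]
      linear_combination ((Φ z) 0 ^ 2 + (Φ z) 1 ^ 2) * hab
    linarith [sq_nonneg (a * (Φ z) 0 + b * (Φ z) 1)]
  · intro s t hs ht
    apply h1
    rw [mem_closedBall_zero_iff, norm_le_one_iff, hΦ0, hΦ1, e2_apply_zero, e2_apply_one]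
    have e : ((-b + c * a) * s + -ρ * a * t + ρ * a) ^ 2 +
        ((a + c * b) * s + -ρ * b * t + ρ * b) ^ 2 = s ^ 2 + (c * s + ρ * (1 - t)) ^ 2 := by
      linear_combination (s ^ 2 + (c * s + ρ * (1 - t)) ^ 2) * hab
    rw [e]
    have b1 : |c * s + ρ * (1 - t)| ≤ 4 / 5 := by
      refine (abs_add_le _ _).trans ?_
      rw [abs_mul, abs_mul, abs_of_pos (show 0 < ρ by linarith), abs_sub_comm 1 t]
      have := mul_le_mul hcabs hs (abs_nonneg s) (by norm_num)
      have := mul_le_mul hρ2 ht (abs_nonneg _) (by norm_num)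
      linarith
    have b2 := sq_le_sq' (abs_le.mp b1).1 (abs_le.mp b1).2
    have b3 := sq_le_sq' (abs_le.mp hs).1 (abs_le.mp hs).2
    linarith
  · intro z hz
    have : Φ (e2 (-(z 0) / 2) (3 / 2 - z 1 / 2)) = (-(1 / 2) : ℝ) • Φ z := by
      apply e2_ext
      · rw [hΦ0, PiLp.smul_apply, hΦ0, e2_apply_zero, e2_apply_one, smul_eq_mul]
        ring
      · rw [hΦ1, PiLp.smul_apply, hΦ1, e2_apply_zero, e2_apply_one, smul_eq_mul]
        ring
    rw [mem_preimage, this]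
    apply h1
    have hn := h2 hz
    rw [mem_closedBall_zero_iff] at hn ⊢
    rw [norm_smul]
    norm_num
    linarith
  · rw [sub_nonneg, div_le_one (by linarith)]
    exact hyρ
  · have : 0 ≤ ‖y‖ / ρ := by positivity
    linarith
  · have hρ0 : ρ ≠ 0 := by linarith
    apply e2_ext
    · rw [hΦ0, e2_apply_zero, e2_apply_one, hy0]
      field_simp
      ring
    · rw [hΦ1, e2_apply_zero, e2_apply_one, hy1]
      field_simp
      ring

lemma exists_ball_image_of_isConvexBody {D : Set E2} (hD : IsConvexBody D)
    (h1 : Metric.closedBall (0:E2) 1 ⊆ D) (h2 : D ⊆ Metric.closedBall (0:E2) 2)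
    {y : E2} (hy : y ∈ D) {V : ℝ} (hV0 : 0 < V)
    (hV : ∀ T : E2 ≃ᵃ[ℝ] E2, y ∈ T '' ((2:ℝ)⁻¹ • squareS) → D ⊆ T '' squareS →
      V ≤ √((T.symm y) 0 * (T.symm y) 1) * |adet T|) :
    ∃ T : E2 ≃ᵃ[ℝ] E2, y ∈ T '' ballE ∧ T '' ballE ⊆ D ∧
      V ≤ 2500 * (√(1 - ‖T.symm y‖) * |adet T|) := by
  obtain ⟨Φ, d, hΦ, hd, rfl⟩ := exists_isNormalised hD h1 h2 hy
  have hΦ0 : 0 < |adet Φ| := abs_pos.mpr (adet_ne_zero Φ)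
  have hsymm : ∀ T : E2 ≃ᵃ[ℝ] E2, (T.trans Φ).symm (Φ (e2 0 d)) = T.symm (e2 0 d) := by
    intro T
    rw [AffineEquiv.symm_apply_eq]
    simp
  obtain ⟨T, hT1, hT2, hT3⟩ := hΦ.exists_ball_image hd (V := V / |adet Φ|) (by positivity)
    (fun T hT1 hT2 => by
      have := hV (T.trans Φ)
        (by rw [AffineEquiv.coe_trans, image_comp]; exact mem_image_of_mem _ hT1)
        (by
          rw [AffineEquiv.coe_trans, image_comp]
          intro z hz
          exact ⟨Φ.symm z, hT2 (by simpa using hz), by simp⟩)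
      rw [hsymm, adet_trans, abs_mul] at this
      rw [div_le_iff₀ hΦ0]
      linarith)
  refine ⟨T.trans Φ, ?_, ?_, ?_⟩
  · rw [AffineEquiv.coe_trans, image_comp]
    exact mem_image_of_mem _ hT1
  · rw [AffineEquiv.coe_trans, image_comp]
    exact image_subset_iff.mpr hT2
  · rw [hsymm, adet_trans, abs_mul]
    rw [div_le_iff₀ hΦ0] at hT3
    linarith

lemma Ufun_set_nonempty {D : Set E2} (h2 : D ⊆ Metric.closedBall (0:E2) 2) {y : E2} (hy : y ∈ D) :
    { r : ℝ | ∃ T : E2 ≃ᵃ[ℝ] E2, y ∈ T '' ((2:ℝ)⁻¹ • squareS) ∧ D ⊆ T '' squareS ∧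
      r = Real.sqrt ((T.symm y) 0 * (T.symm y) 1) * |adet T| }.Nonempty := by
  have h : ∀ z ∈ D, ∀ i, |z i| ≤ 2 := fun z hz i =>
    (PiLp.norm_apply_le z i).trans (by simpa using h2 hz)
  obtain ⟨T, hT1, hT2, -⟩ := exists_parallelogram hy (a := 1 / 8) (b := 0) (c := 0) (d := 1 / 8)
    (p := 1 / 4) (q := 1 / 4) (by norm_num)
    (fun z hz => by
      have := abs_le.mp (h z hz 0)
      constructor <;> linarith [this.1, this.2])
    (fun z hz => by
      have := abs_le.mp (h z hz 1)
      constructor <;> linarith [this.1, this.2])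
  exact ⟨_, T, hT1, hT2, rfl⟩

/-- The point `τ_n(x)` is a slight contraction of `x`. -/
lemma exists_contraction {D : Set E2} (hD : Convex ℝ D) (h0 : (0:E2) ∈ D) {n : ℕ} (hn : 1 ≤ n)
    {x y : E2} (hx : x ∈ D)
    (h : (x ∈ (1 - (16 * (n:ℝ)^2)⁻¹) • D ∧ y = x) ∨
     (x ∉ (1 - (16 * (n:ℝ)^2)⁻¹) • D ∧ ∃ t : ℝ, 0 < t ∧ y = t • x ∧
        t • x ∈ (1 - (16 * (n:ℝ)^2)⁻¹) • D ∧
        ∀ s : ℝ, 0 < s → s • x ∈ (1 - (16 * (n:ℝ)^2)⁻¹) • D → s ≤ t)) :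
    y ∈ (1 - (16 * (n:ℝ)^2)⁻¹) • D ∧
      ∃ τ ∈ Icc (1 - (16 * (n:ℝ) ^ 2)⁻¹) 1, y = τ • x := by
  have hn' : (1:ℝ) ≤ n := by exact_mod_cast hn
  have hδ : (16 * (n:ℝ) ^ 2)⁻¹ < 1 := by
    refine inv_lt_one_of_one_lt₀ ?_
    nlinarith
  have hδ0 : 0 < (16 * (n:ℝ) ^ 2)⁻¹ := by positivity
  set δ := (16 * (n:ℝ) ^ 2)⁻¹
  rcases h with ⟨hxm, rfl⟩ | ⟨hxn, t, ht, rfl, htm, hmax⟩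
  · exact ⟨hxm, 1, ⟨by linarith, le_rfl⟩, (one_smul ℝ _).symm⟩
  · refine ⟨htm, t, ⟨hmax _ (by linarith) (smul_mem_smul_set hx), ?_⟩, rfl⟩
    by_contra! h
    apply hxn
    have hc : Convex ℝ ((1 - δ) • D) := hD.smul _
    have h0' : (0:E2) ∈ (1 - δ) • D := ⟨0, h0, smul_zero _⟩
    have := hc.smul_mem_of_zero_mem h0' htm (t := t⁻¹)
      ⟨by positivity, inv_le_one_of_one_le₀ h.le⟩
    rwa [smul_smul, inv_mul_cancel₀ ht.ne', one_smul] at this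

end Comparison

/-- Theorem 3.1: computation of the Christoffel function via `L` and `U`. -/
theorem stmt3 : ∃ c : ℝ, 1 ≤ c ∧ ∀ D : Set E2, IsConvexBody D →
    Metric.closedBall (0:E2) 1 ⊆ D → D ⊆ Metric.closedBall (0:E2) 2 →
    ∀ n : ℕ, 1 ≤ n → ∀ x ∈ D, ∀ y : E2,
    ((x ∈ (1 - (16 * (n:ℝ)^2)⁻¹) • D ∧ y = x) ∨
     (x ∉ (1 - (16 * (n:ℝ)^2)⁻¹) • D ∧ ∃ t : ℝ, 0 < t ∧ y = t • x ∧
        t • x ∈ (1 - (16 * (n:ℝ)^2)⁻¹) • D ∧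
        ∀ s : ℝ, 0 < s → s • x ∈ (1 - (16 * (n:ℝ)^2)⁻¹) • D → s ≤ t)) →
    (c⁻¹ * ((n:ℝ)^2)⁻¹ * Lfun y D ≤ christoffel 2 n x D ∧
     christoffel 2 n x D ≤ c * ((n:ℝ)^2)⁻¹ * Lfun y D ∧
     c⁻¹ * ((n:ℝ)^2)⁻¹ * Ufun y D ≤ christoffel 2 n x D ∧
     christoffel 2 n x D ≤ c * ((n:ℝ)^2)⁻¹ * Ufun y D) := by
  refine ⟨10 ^ 13, by norm_num, fun D hD h1 h2 n hn x hx y hxy => ?_⟩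
  have hn' : (1:ℝ) ≤ n := by exact_mod_cast hn
  have h0D : (0:E2) ∈ D := h1 (by simp)
  obtain ⟨hyD, τ, hτ, hyx⟩ := exists_contraction hD.1 h0D hn hx hxy
  have hy : y ∈ D := by
    rw [hyx]
    refine hD.1.smul_mem_of_zero_mem h0D hx ⟨le_trans ?_ hτ.1, hτ.2⟩
    rw [sub_nonneg]
    refine inv_le_one_of_one_le₀ ?_
    nlinarith
  set N := ((n:ℝ) ^ 2)⁻¹ with hN
  have hN0 : 0 < N := by positivity
  set lam := christoffel 2 n x D with hlam
  have hlam0 : 0 ≤ lam := by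
    refine Real.sInf_nonneg ?_
    rintro _ ⟨p, -, -, rfl⟩
    exact integral_nonneg fun _ => sq_nonneg _
  have hlower : ∀ T : E2 ≃ᵃ[ℝ] E2, y ∈ T '' ballE → T '' ballE ⊆ D →
      √(1 - ‖T.symm y‖) * |adet T| ≤ 64000000 / N * lam := by
    intro T hT1 hT2
    have := mul_le_christoffel hD h0D hn hτ hyx T hT1 hT2
    rw [← hN, ← hlam] at this
    rw [div_mul_eq_mul_div, le_div_iff₀ hN0]
    linarith
  have hL : Lfun y D ≤ 64000000 / N * lam := by
    refine Real.sSup_le ?_ (by positivity)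
    rintro _ ⟨T, hT1, hT2, rfl⟩
    exact hlower T hT1 hT2
  have hL0 : 0 ≤ Lfun y D := by
    refine Real.sSup_nonneg ?_
    rintro _ ⟨T, -, -, rfl⟩
    positivity
  have hU0 : 0 ≤ Ufun y D := by
    refine Real.sInf_nonneg ?_
    rintro _ ⟨T, -, -, rfl⟩
    positivity
  have hU : lam ≤ 28672 ^ 2 * N * Ufun y D := by
    rw [mul_comm, ← div_le_iff₀ (by positivity)]
    refine le_csInf (Ufun_set_nonempty h2 hy) ?_
    rintro _ ⟨T, -, hT, rfl⟩
    rw [div_le_iff₀ (by positivity), mul_comm]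
    exact christoffel_le hD h1 h2 hn hx hτ hyx hyD T hT
  have hUL : Ufun y D ≤ 2500 * Lfun y D := by
    rcases hU0.eq_or_lt with h | h
    · rw [← h]
      positivity
    · obtain ⟨T, hT1, hT2, hT3⟩ := exists_ball_image_of_isConvexBody hD h1 h2 hy h
        fun T hT1 hT2 => csInf_le ⟨0, by rintro _ ⟨T, -, -, rfl⟩; positivity⟩ ⟨T, hT1, hT2, rfl⟩
      refine hT3.trans (mul_le_mul_of_nonneg_left ?_ (by norm_num))
      refine le_csSup ⟨64000000 / N * lam, ?_⟩ ⟨T, hT1, hT2, rfl⟩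
      rintro _ ⟨T, hT1, hT2, rfl⟩
      exact hlower T hT1 hT2
  rw [div_mul_eq_mul_div, le_div_iff₀ hN0] at hL
  have hNL := mul_le_mul_of_nonneg_left hUL hN0.le
  have hNL0 := mul_nonneg hN0.le hL0
  have hNU0 := mul_nonneg hN0.le hU0
  refine ⟨?_, ?_, ?_, ?_⟩
  · norm_num
    linarith
  · norm_num at hU ⊢
    linarith
  · norm_num
    linarith
  · norm_num at hU ⊢
    linarith
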